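/- arXiv:1307.4532 — 3 statements merged into one kernel-verified Lean document; each statement's English description precedes it below -/
import Mathlib

section
/- Let q be a prime power and let 0 ≤ t ≤ q, 2 ≤ m ≤ q−1, and 0 ≤ ℓ ≤ m−1 be integers. Set n = t + (q²−q)/2. Then there exist F_q-linear codes D ⊆ C of length n such that: dim(C) − dim(D) = m(m−1)/2 + ℓ; the minimum distance of the Euclidean dual D^⊥ equals 2; and the minimum distance of C is at least the designed distance δ. (Equivalently, by the CSS construction applied to the nested pair D = C_q(t,1,0) ⊆ C_q(t,m,ℓ) = C, there exists a pure asymmetric quantum CSS code with parameters [[n, m(m−1)/2 + ℓ, {d_z ≥ δ, d_x = 2}]]_q.) -/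
/-- The Euclidean dual of a linear code `C ⊆ F^ι`. -/
noncomputable def dualCode {F : Type*} [Field F] {ι : Type*} [Fintype ι]
    (C : Submodule F (ι → F)) : Submodule F (ι → F) where
  carrier := {u | ∀ v ∈ C, ∑ i, u i * v i = 0}
  add_mem' := by
    intro a b ha hb v hv
    have h : ∑ i, (a i + b i) * v i = (∑ i, a i * v i) + ∑ i, b i * v i := by
      rw [← Finset.sum_add_distrib]
      exact Finset.sum_congr rfl fun i _ => add_mul _ _ _
    simp [h, ha v hv, hb v hv]
  zero_mem' := by
    intro v hv
    simp
  smul_mem' := by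
    intro c a ha v hv
    have h : ∑ i, (c * a i) * v i = c * ∑ i, a i * v i := by
      rw [Finset.mul_sum]
      exact Finset.sum_congr rfl fun i _ => mul_assoc _ _ _
    simp [smul_eq_mul, h, ha v hv]

/-- The minimum distance of a linear code: the least Hamming weight of a
nonzero codeword. -/
noncomputable def minDist {F : Type*} [Field F] [DecidableEq F] {ι : Type*} [Fintype ι]
    (C : Submodule F (ι → F)) : ℕ :=
  sInf {w | ∃ v ∈ C, v ≠ 0 ∧ hammingNorm v = w}


open Polynomial in
noncomputable def fpoly {F : Type*} [Field F] (q m : ℕ) (c : ℕ → ℕ → F) : F[X] :=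
  ∑ i ∈ Finset.range m, ∑ j ∈ Finset.range m, monomial (i * q + j) (c i j)

section aux
open Polynomial

lemma fixed_mem {F K : Type*} [Field F] [Fintype F] [Field K] [Algebra F K] (x : K)
    (hx : x ^ Fintype.card F = x) : ∃ a : F, algebraMap F K a = x := by
  classical
  by_contra! h
  have h1 : 1 < Fintype.card F := Fintype.one_lt_card
  have hne := FiniteField.X_pow_card_sub_X_ne_zero K h1
  have hsub : (insert x (Finset.univ.image (algebraMap F K))) ⊆
      (X ^ Fintype.card F - X : K[X]).roots.toFinset := by
    intro y hy
    rw [Multiset.mem_toFinset, mem_roots hne]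
    rcases Finset.mem_insert.1 hy with rfl | hy
    · simp [hx]
    · obtain ⟨a, -, rfl⟩ := Finset.mem_image.1 hy
      simp [← map_pow, FiniteField.pow_card]
  have h2 := Finset.card_le_card hsub
  rw [Finset.card_insert_of_notMem (by simpa using h),
    Finset.card_image_of_injective _ (algebraMap F K).injective, Finset.card_univ] at h2
  have h3 := (Multiset.toFinset_card_le _).trans (card_roots' (X ^ Fintype.card F - X : K[X]))
  rw [FiniteField.X_pow_card_sub_X_natDegree_eq K h1] at h3
  omega

lemma card_roots_two {K : Type*} [Field K] [DecidableEq K] {f : K[X]} (hf : f ≠ 0)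
    (A E : Finset K) (hd : Disjoint A E)
    (hA : ∀ a ∈ A, f.IsRoot a ∧ (derivative f).IsRoot a) (hE : ∀ a ∈ E, f.IsRoot a) :
    2 * A.card + E.card ≤ f.natDegree := by
  have : A.val + A.val + E.val ≤ f.roots := by
    rw [Multiset.le_iff_count]
    intro x
    rw [count_roots, Multiset.count_add, Multiset.count_add]
    have e1 := Multiset.nodup_iff_count_le_one.1 A.nodup x
    have e2 := Multiset.nodup_iff_count_le_one.1 E.nodup x
    by_cases h1 : x ∈ A
    · have h2 : x ∉ E := Finset.disjoint_left.1 hd h1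
      have h3 := (one_lt_rootMultiplicity_iff_isRoot hf).2 (hA x h1)
      rw [Multiset.count_eq_zero_of_notMem (s := E.val) h2]
      omega
    · rw [Multiset.count_eq_zero_of_notMem (s := A.val) h1]
      by_cases h2 : x ∈ E
      · have := (rootMultiplicity_pos hf).2 (hE x h2)
        omega
      · rw [Multiset.count_eq_zero_of_notMem (s := E.val) h2]
        omega
  have := (Multiset.card_le_card this).trans (card_roots' f)
  simp only [Multiset.card_add, Finset.card_val] at this
  omega

lemma card_roots_one {K : Type*} [Field K] [DecidableEq K] {f : K[X]} (hf : f ≠ 0)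
    (E : Finset K) (hE : ∀ a ∈ E, f.IsRoot a) : E.card ≤ f.natDegree := by
  simpa using card_roots_two hf ∅ E (by simp) (by simp) hE

variable {F : Type*} [Field F] {q m ℓ : ℕ} {c : ℕ → ℕ → F}

lemma fpoly_coeff (hmq : m ≤ q) {i j : ℕ} (hi : i < m) (hj : j < m) :
    (fpoly q m c).coeff (i * q + j) = c i j := by
  unfold fpoly
  simp only [finsetSum_coeff, coeff_monomial]
  rw [Finset.sum_eq_single i, Finset.sum_eq_single j]
  · simp
  · intro b hb hbj
    rw [if_neg]; omega
  · simp [hj]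
  · intro b hb hbi
    apply Finset.sum_eq_zero
    intro k hk
    rw [if_neg]
    intro h
    apply hbi
    have hk' : k < q := by simp at hk; omega
    have h1 : (b * q + k) / q = b := by
      rw [mul_comm, Nat.mul_add_div (by omega), Nat.div_eq_of_lt hk', add_zero]
    have h2 : (i * q + j) / q = i := by
      rw [mul_comm, Nat.mul_add_div (by omega), Nat.div_eq_of_lt (by omega), add_zero]
    rw [← h1, ← h2, h]
  · simp [hi]

lemma fpoly_natDegree (hmq : m ≤ q) (hl : ∀ i j, c i j ≠ 0 → i = m - 1 → j ≤ ℓ) :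
    (fpoly q m c).natDegree ≤ q * (m - 1) + ℓ := by
  unfold fpoly
  apply natDegree_sum_le_of_forall_le
  intro i hi
  apply natDegree_sum_le_of_forall_le
  intro j hj
  simp only [Finset.mem_range] at hi hj
  by_cases h : c i j = 0
  · simp [h]
  refine (natDegree_monomial_le _).trans ?_
  by_cases h1 : i = m - 1
  · have := hl i j h h1
    rw [h1, mul_comm]; omega
  · have : (i + 1) * q ≤ (m - 1) * q := Nat.mul_le_mul_right _ (by omega)
    rw [mul_comm q]
    rw [add_mul] at this
    omega

lemma fpoly_aeval {K : Type*} [Field K] [Algebra F K] (x : K) :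
    aeval x (fpoly q m c) = ∑ i ∈ Finset.range m, ∑ j ∈ Finset.range m,
      algebraMap F K (c i j) * x ^ (i * q + j) := by
  simp [fpoly, aeval_monomial]

lemma fpoly_frob [Fintype F] {K : Type*} [Field K] [Fintype K] [Algebra F K]
    (hF : Fintype.card F = q) (hK : Fintype.card K = q ^ 2) (hs : ∀ i j, c i j = c j i) (x : K) :
    aeval (x ^ q) (fpoly q m c) = aeval x (fpoly q m c) := by
  rw [fpoly_aeval, fpoly_aeval, Finset.sum_comm]
  refine Finset.sum_congr rfl fun j _ => Finset.sum_congr rfl fun i _ => ?_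
  rw [hs i j]
  congr 1
  have : x ^ (q ^ 2) = x := by rw [← hK, FiniteField.pow_card]
  rw [← pow_mul, mul_add, show q * (i * q) = q ^ 2 * i by ring, pow_add, pow_mul, this,
    ← pow_add]
  congr 1; ring

lemma fpoly_mem [Fintype F] {K : Type*} [Field K] [Fintype K] [Algebra F K]
    (hF : Fintype.card F = q) (hK : Fintype.card K = q ^ 2) (hs : ∀ i j, c i j = c j i) (x : K) :
    ∃ a : F, algebraMap F K a = aeval x (fpoly q m c) := by
  apply fixed_mem
  have := aeval_algHom_apply (FiniteField.frobeniusAlgHom F K) x (fpoly q m c)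
  simp only [FiniteField.coe_frobeniusAlgHom] at this
  rw [← this, hF, fpoly_frob hF hK hs]

lemma fpoly_eval [Fintype F] (hF : Fintype.card F = q) (a : F) :
    eval a (fpoly q m c) = ∑ i ∈ Finset.range m, ∑ j ∈ Finset.range m, c i j * a ^ (i + j) := by
  have := fpoly_aeval (q := q) (m := m) (c := c) a
  rw [coe_aeval_eq_eval] at this
  rw [this]
  refine Finset.sum_congr rfl fun j _ => Finset.sum_congr rfl fun i _ => ?_
  rw [pow_add, mul_comm j q, pow_mul, ← hF, FiniteField.pow_card, pow_add]
  rfl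

lemma fpoly_deriv [Fintype F] (hF : Fintype.card F = q) (a : F) :
    eval a (derivative (fpoly q m c)) =
      ∑ i ∈ Finset.range m, ∑ j ∈ Finset.range m, c i j * j * a ^ (i + j - 1) := by
  simp only [fpoly, derivative_sum, derivative_monomial, eval_finsetSum, eval_monomial]
  refine Finset.sum_congr rfl fun i _ => Finset.sum_congr rfl fun j _ => ?_
  have hq0 : (q : F) = 0 := by rw [← hF]; exact FiniteField.cast_card_eq_zero F
  rcases Nat.eq_zero_or_pos j with rfl | hj
  · simp [hq0]
  · have : a ^ q = a := by rw [← hF, FiniteField.pow_card]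
    rw [Nat.add_sub_assoc hj, Nat.add_sub_assoc hj, pow_add, mul_comm i q, pow_mul, this, pow_add]
    simp [hq0]

/-- the diagonal polynomial -/
noncomputable def gpoly (m : ℕ) (c : ℕ → ℕ → F) : F[X] :=
  ∑ i ∈ Finset.range m, ∑ j ∈ Finset.range m, monomial (i + j) (c i j)

lemma gpoly_eval (a : F) :
    eval a (gpoly m c) = ∑ i ∈ Finset.range m, ∑ j ∈ Finset.range m, c i j * a ^ (i + j) := by
  simp [gpoly, eval_finsetSum]

lemma gpoly_deriv [Fintype F] (hF : Fintype.card F = q) (hs : ∀ i j, c i j = c j i) (a : F) :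
    eval a (derivative (gpoly m c)) = 2 * eval a (derivative (fpoly q m c)) := by
  rw [fpoly_deriv hF, two_mul]
  nth_rw 1 [Finset.sum_comm]
  simp only [gpoly, derivative_sum, derivative_monomial, eval_finsetSum, eval_monomial,
    ← Finset.sum_add_distrib]
  refine Finset.sum_congr rfl fun i _ => Finset.sum_congr rfl fun j _ => ?_
  rw [hs j i, add_comm j i]
  push_cast
  ring

lemma gpoly_natDegree (hm : 2 ≤ m) (hs : ∀ i j, c i j = c j i)
    (hl : ∀ i j, c i j ≠ 0 → i = m - 1 → j ≤ ℓ) :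
    (gpoly m c).natDegree ≤ max (2 * (m - 2)) (m + ℓ - 1) := by
  unfold gpoly
  apply natDegree_sum_le_of_forall_le
  intro i hi
  apply natDegree_sum_le_of_forall_le
  intro j hj
  simp only [Finset.mem_range] at hi hj
  by_cases h : c i j = 0
  · simp [h]
  refine (natDegree_monomial_le _).trans ?_
  have h1 := hl i j h
  have h2 := hl j i (by rwa [hs])
  omega

/-- the polynomial formed by the diagonal coefficients -/
noncomputable def hpoly (m : ℕ) (c : ℕ → ℕ → F) : F[X] :=
  ∑ i ∈ Finset.range m, monomial i (c i i)

lemma hpoly_eval [Fintype F] (hF : Fintype.card F = q) (h2 : (2 : F) = 0)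
    (hs : ∀ i j, c i j = c j i) (a : F) :
    eval (a ^ 2) (hpoly m c) = eval a (fpoly q m c) := by
  classical
  rw [fpoly_eval hF, ← Finset.sum_product', ← Finset.diag_union_offDiag,
    Finset.sum_union (Finset.disjoint_diag_offDiag _), Finset.sum_diag]
  rw [Finset.sum_involution (s := (Finset.range m).offDiag) (fun x _ => x.swap)]
  · simp only [hpoly, eval_finsetSum, eval_monomial, add_zero]
    refine Finset.sum_congr rfl fun i _ => ?_
    rw [← pow_mul, two_mul]
  · rintro ⟨i, j⟩ _
    simp only [Prod.swap]
    rw [hs j i, add_comm j i, ← two_mul, h2, zero_mul]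
  · rintro ⟨i, j⟩ h _ h'
    simp at h h'
    tauto
  · rintro ⟨i, j⟩ h
    simp at h ⊢
    tauto
  · rintro ⟨i, j⟩ h
    rfl

lemma hpoly_natDegree {d : ℕ} (hl : ∀ i < m, c i i ≠ 0 → i ≤ d) :
    (hpoly m c).natDegree ≤ d := by
  unfold hpoly
  apply natDegree_sum_le_of_forall_le
  intro i hi
  simp only [Finset.mem_range] at hi
  by_cases h : c i i = 0
  · simp [h]
  exact (natDegree_monomial_le _).trans (hl i hi h)


lemma pow_q_inj {K : Type*} [Field K] [Fintype K] (hK : Fintype.card K = q ^ 2) :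
    Function.Injective (fun x : K => x ^ q) := by
  intro x y h
  have e : ∀ x : K, (x ^ q) ^ q = x := fun x => by
    rw [← pow_mul, ← pow_two, ← hK, FiniteField.pow_card]
  have := congrArg (· ^ q) h
  simpa [e] using this

lemma exists_B [Fintype F] {K : Type*} [Field K] [Fintype K] [Algebra F K]
    (hF : Fintype.card F = q) (hK : Fintype.card K = q ^ 2) :
    ∃ B : Finset K, 2 * B.card + q = q ^ 2 ∧ (∀ b ∈ B, b ^ q ∉ B) ∧
      ∀ b ∈ B, ∀ a : F, algebraMap F K a ≠ b := by
  classical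
  have e : ∀ x : K, (x ^ q) ^ q = x := fun x => by
    rw [← pow_mul, ← pow_two, ← hK, FiniteField.pow_card]
  let φ := Fintype.equivFin K
  let B : Finset K := Finset.univ.filter fun x => φ x < φ (x ^ q)
  let B' : Finset K := Finset.univ.filter fun x => φ (x ^ q) < φ x
  let A : Finset K := Finset.univ.filter fun x => φ x = φ (x ^ q)
  have hB' : B' = B.image (fun x => x ^ q) := by
    ext x
    simp only [B, B', Finset.mem_filter, Finset.mem_univ, true_and, Finset.mem_image]
    constructor
    · intro h
      exact ⟨x ^ q, by rwa [e], e x⟩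
    · rintro ⟨y, hy, rfl⟩
      rwa [e]
  have hA : A = Finset.univ.image (algebraMap F K) := by
    ext x
    simp only [A, Finset.mem_filter, Finset.mem_univ, true_and, Finset.mem_image]
    constructor
    · intro h
      exact fixed_mem x (by rw [hF]; exact (φ.injective h).symm)
    · rintro ⟨a, rfl⟩
      rw [← map_pow, ← hF, FiniteField.pow_card]
  have cA : A.card = q := by
    rw [hA, Finset.card_image_of_injective _ (algebraMap F K).injective, Finset.card_univ, hF]
  have cB' : B'.card = B.card := by
    rw [hB', Finset.card_image_of_injective _ (pow_q_inj hK)]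
  have hu : (Finset.univ : Finset K) = (A ∪ B) ∪ B' := by
    ext x
    simp only [A, B, B', Finset.mem_filter, Finset.mem_univ, true_and, Finset.mem_union]
    rcases lt_trichotomy (φ x) (φ (x ^ q)) with h | h | h <;> simp [h]
  have hc := congrArg Finset.card hu
  rw [Finset.card_union_of_disjoint, Finset.card_union_of_disjoint, Finset.card_univ, hK, cA,
    cB'] at hc
  · refine ⟨B, by omega, ?_, ?_⟩
    · intro b hb
      simp only [B, Finset.mem_filter, Finset.mem_univ, true_and, e] at hb ⊢
      exact not_lt.2 hb.le
    · rintro b hb a rfl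
      simp only [B, Finset.mem_filter, Finset.mem_univ, true_and] at hb
      rw [← map_pow, ← hF, FiniteField.pow_card] at hb
      exact lt_irrefl _ hb
  · rw [Finset.disjoint_left]
    intro x hx hx'
    simp only [A, B, Finset.mem_filter, Finset.mem_univ, true_and] at hx hx'
    exact hx'.ne hx
  · rw [Finset.disjoint_left]
    intro x hx hx'
    simp only [A, B, B', Finset.mem_filter, Finset.mem_univ, true_and, Finset.mem_union] at hx hx'
    rcases hx with h | h
    · exact hx'.ne h.symm
    · exact lt_asymm h hx'

lemma pair_count [Fintype F] {K : Type*} [Field K] [Fintype K] [Algebra F K] [DecidableEq K]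
    (hF : Fintype.card F = q) (hK : Fintype.card K = q ^ 2) (hs : ∀ i j, c i j = c j i)
    (hf : fpoly q m c ≠ 0) (A : Finset F) (hA : ∀ a ∈ A, eval a (fpoly q m c) = 0)
    (E : Finset K) (hE1 : ∀ b ∈ E, b ^ q ∉ E) (hE2 : ∀ b ∈ E, ∀ a : F, algebraMap F K a ≠ b)
    (hE : ∀ b ∈ E, aeval b (fpoly q m c) = 0) :
    A.card + 2 * E.card ≤ (fpoly q m c).natDegree ∧
    ((∀ a ∈ A, eval a (derivative (fpoly q m c)) = 0) →
      2 * A.card + 2 * E.card ≤ (fpoly q m c).natDegree) := by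
  have hfK : (fpoly q m c).map (algebraMap F K) ≠ 0 :=
    (Polynomial.map_ne_zero_iff (algebraMap F K).injective).2 hf
  have cE : (E ∪ E.image (fun x => x ^ q)).card = 2 * E.card := by
    rw [Finset.card_union_of_disjoint, Finset.card_image_of_injective _ (pow_q_inj hK)]
    · ring
    · rw [Finset.disjoint_left]
      intro x hx hx'
      obtain ⟨y, hy, rfl⟩ := Finset.mem_image.1 hx'
      exact hE1 y hy hx
  have cA : (A.image (algebraMap F K)).card = A.card :=
    Finset.card_image_of_injective _ (algebraMap F K).injective
  have hd : Disjoint (A.image (algebraMap F K)) (E ∪ E.image (fun x => x ^ q)) := by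
    rw [Finset.disjoint_left]
    intro x hx hx'
    obtain ⟨a, ha, rfl⟩ := Finset.mem_image.1 hx
    rcases Finset.mem_union.1 hx' with h | h
    · exact hE2 _ h a rfl
    · obtain ⟨y, hy, h⟩ := Finset.mem_image.1 h
      apply hE2 y hy a
      apply pow_q_inj hK
      change _ ^ q = y ^ q
      change y ^ q = _ at h
      rw [h, ← map_pow, ← hF, FiniteField.pow_card]
  have rE : ∀ x ∈ E ∪ E.image (fun x => x ^ q),
      ((fpoly q m c).map (algebraMap F K)).IsRoot x := by
    intro x hx
    rw [IsRoot.def, eval_map_algebraMap]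
    rcases Finset.mem_union.1 hx with h | h
    · exact hE x h
    · obtain ⟨y, hy, rfl⟩ := Finset.mem_image.1 h
      rw [fpoly_frob hF hK hs, hE y hy]
  have rA : ∀ x ∈ A.image (algebraMap F K), ((fpoly q m c).map (algebraMap F K)).IsRoot x := by
    intro x hx
    obtain ⟨a, ha, rfl⟩ := Finset.mem_image.1 hx
    rw [IsRoot.def, eval_map_algebraMap, aeval_algebraMap_apply, coe_aeval_eq_eval, hA a ha,
      map_zero]
  have hdeg : ((fpoly q m c).map (algebraMap F K)).natDegree = (fpoly q m c).natDegree :=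
    natDegree_map _
  constructor
  · have := card_roots_one hfK (A.image (algebraMap F K) ∪ (E ∪ E.image (fun x => x ^ q))) (by
      intro a ha
      rcases Finset.mem_union.1 ha with h | h
      · exact rA a h
      · exact rE a h)
    rwa [Finset.card_union_of_disjoint hd, cE, cA, hdeg] at this
  · intro hA'
    have := card_roots_two hfK _ _ hd (fun x hx => ⟨rA x hx, by
      obtain ⟨a, ha, rfl⟩ := Finset.mem_image.1 hx
      rw [IsRoot.def, derivative_map, eval_map_algebraMap, aeval_algebraMap_apply,
        coe_aeval_eq_eval, hA' a ha, map_zero]⟩) rE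
    rwa [cE, cA, hdeg] at this

lemma main_count [Fintype F] [DecidableEq F] {K : Type*} [Field K] [Fintype K] [Algebra F K]
    [DecidableEq K] {t : ℕ}
    (hm2 : 2 ≤ m) (hmq : m ≤ q - 1)
    (hF : Fintype.card F = q) (hK : Fintype.card K = q ^ 2) (hs : ∀ i j, c i j = c j i)
    (hl : ∀ i j, c i j ≠ 0 → i = m - 1 → j ≤ ℓ)
    (hf : fpoly q m c ≠ 0) (T : Finset F) (hT : T.card = t)
    (B : Finset K) (hB1 : ∀ b ∈ B, b ^ q ∉ B) (hB2 : ∀ b ∈ B, ∀ a : F, algebraMap F K a ≠ b)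
    (g : ℤ)
    (hg : g = if Odd q then min (max (2 * ((m : ℤ) - 2)) ((m : ℤ) + ℓ - 1)) (t : ℤ)
      else if ℓ ≤ m - 2 then max (min ((m : ℤ) - 2) (t : ℤ)) (2 * (t : ℤ) - q)
      else max (min ((m : ℤ) - 1) (t : ℤ)) (2 * (t : ℤ) - q)) :
    2 * (((T.filter fun a => eval a (fpoly q m c) = 0).card : ℤ) +
      (B.filter fun b => aeval b (fpoly q m c) = 0).card) ≤ q * (m - 1) + ℓ + g := by
  set T0 := T.filter fun a => eval a (fpoly q m c) = 0 with hT0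
  set B0 := B.filter fun b => aeval b (fpoly q m c) = 0 with hB0
  have hdeg := fpoly_natDegree (q := q) (by omega) hl
  have hTq : t ≤ q := by rw [← hT, ← hF]; exact Finset.card_le_univ T
  have hT0t : T0.card ≤ t := by rw [← hT]; exact Finset.card_filter_le _ _
  have hpc := fun (A : Finset F) hA => pair_count (K := K) hF hK hs hf A hA B0
    (fun b hb h => hB1 b (Finset.mem_filter.1 hb).1 (Finset.mem_filter.1 h).1)
    (fun b hb => hB2 b (Finset.mem_filter.1 hb).1)
    (fun b hb => (Finset.mem_filter.1 hb).2)
  have h1 := (hpc T0 (fun a ha => (Finset.mem_filter.1 ha).2)).1.trans hdeg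
  have hN : ((q * (m - 1) + ℓ : ℕ) : ℤ) = q * (m - 1) + ℓ := by
    push_cast [Nat.cast_sub (show 1 ≤ m by omega)]; ring
  rw [← hN]
  generalize q * (m - 1) + ℓ = N at *
  split_ifs at hg with hodd hlm
  · by_cases hG : gpoly m c = 0
    · have hz : ∀ a : F, eval a (fpoly q m c) = 0 := fun a => by
        rw [fpoly_eval hF, ← gpoly_eval, hG, eval_zero]
      have h2 : (2 : F) ≠ 0 := by
        intro h
        have : ringChar F = 2 := by
          apply (CharP.ringChar_of_prime_eq_zero Nat.prime_two (by exact_mod_cast h))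
        have := FiniteField.even_card_of_char_two this
        rw [hF] at this
        have := Nat.odd_iff.1 hodd
        omega
      have hd : ∀ a : F, eval a (derivative (fpoly q m c)) = 0 := fun a => by
        have := gpoly_deriv (m := m) (c := c) hF hs a
        rw [hG, derivative_zero, eval_zero] at this
        exact (mul_eq_zero.1 this.symm).resolve_left h2
      have h3 := ((hpc Finset.univ (fun a _ => hz a)).2 (fun a _ => hd a)).trans hdeg
      rw [Finset.card_univ, hF] at h3
      omega
    · have hle : T0.card ≤ (gpoly m c).natDegree := card_roots_one hG T0 (by
        intro a ha
        rw [IsRoot.def, gpoly_eval, ← fpoly_eval hF]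
        exact (Finset.mem_filter.1 ha).2)
      have := hle.trans (gpoly_natDegree hm2 hs hl)
      omega
  all_goals
    have h2 : (2 : F) = 0 := by
      have h0 : ringChar F = 2 := by
        rw [FiniteField.even_card_iff_char_two, hF]
        exact Nat.even_iff.1 (Nat.not_odd_iff_even.1 hodd)
      have h00 := ringChar.Nat.cast_ringChar (R := F)
      rw [h0] at h00
      exact_mod_cast h00
    by_cases hH : hpoly m c = 0
    · have hz : ∀ a : F, eval a (fpoly q m c) = 0 := fun a => by
        rw [← hpoly_eval hF h2 hs, hH, eval_zero]
      have h3 := (hpc Finset.univ (fun a _ => hz a)).1.trans hdeg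
      rw [Finset.card_univ, hF] at h3
      omega
    have hle : T0.card ≤ (hpoly m c).natDegree := by
      have hinj : Function.Injective (fun a : F => a ^ 2) := by
        intro a b hab
        simp only at hab
        have : (a - b) ^ 2 = 0 := by linear_combination hab + (b ^ 2 - a * b) * h2
        exact sub_eq_zero.1 (pow_eq_zero_iff (two_ne_zero) |>.1 this)
      rw [← Finset.card_image_of_injective T0 hinj]
      refine card_roots_one hH _ ?_
      intro x hx
      obtain ⟨a, ha, rfl⟩ := Finset.mem_image.1 hx
      rw [IsRoot.def, hpoly_eval hF h2 hs]
      exact (Finset.mem_filter.1 ha).2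
  · have := hle.trans (hpoly_natDegree (d := m - 2) (by
      intro i hi h
      have := hl i i h
      omega))
    omega
  · have := hle.trans (hpoly_natDegree (d := m - 1) (by
      intro i hi h
      omega))
    omega

end aux

section final
open Polynomial

lemma dual_one {F : Type*} [Field F] [DecidableEq F] {n : ℕ} (hn : 2 ≤ n) :
    minDist (dualCode (Submodule.span F {(fun _ => 1 : Fin n → F)})) = 2 := by
  have hmem : ∀ u : Fin n → F, u ∈ dualCode (Submodule.span F {(fun _ => 1 : Fin n → F)}) ↔
      ∑ i, u i = 0 := by
    intro u
    constructor
    · intro h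
      simpa using h _ (Submodule.subset_span rfl)
    · intro h v hv
      obtain ⟨a, rfl⟩ := Submodule.mem_span_singleton.1 hv
      simp [← Finset.sum_mul, h]
  unfold minDist
  apply le_antisymm
  · apply Nat.sInf_le
    let i0 : Fin n := ⟨0, by omega⟩
    let i1 : Fin n := ⟨1, by omega⟩
    have h01 : i0 ≠ i1 := by simp [i0, i1]
    refine ⟨fun i => if i = i0 then 1 else if i = i1 then -1 else 0, ?_, ?_, ?_⟩
    · rw [hmem, ← Finset.add_sum_erase _ _ (Finset.mem_univ i0),
        ← Finset.add_sum_erase _ _ (Finset.mem_erase.2 ⟨h01.symm, Finset.mem_univ i1⟩),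
        Finset.sum_eq_zero]
      · simp [h01.symm]
      · intro i hi
        simp only [Finset.mem_erase] at hi
        simp [hi.1, hi.2.1]
    · intro h
      simpa using congrFun h i0
    · unfold hammingNorm
      have : (Finset.univ.filter fun i : Fin n =>
          (if i = i0 then (1 : F) else if i = i1 then -1 else 0) ≠ 0) = {i0, i1} := by
        ext i
        by_cases h0 : i = i0
        · simp [h0]
        · by_cases h1 : i = i1 <;> simp [h0, h1, h01.symm]
      rw [this, Finset.card_pair h01]
  · refine le_csInf ?_ ?_
    · by_contra h
      rw [Set.not_nonempty_iff_eq_empty] at h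
      let i0 : Fin n := ⟨0, by omega⟩
      let i1 : Fin n := ⟨1, by omega⟩
      have h01 : i0 ≠ i1 := by simp [i0, i1]
      have : hammingNorm (Pi.single i0 1 - Pi.single i1 1 : Fin n → F) ∈
          {w | ∃ v ∈ dualCode (Submodule.span F {(fun _ => 1 : Fin n → F)}),
            v ≠ 0 ∧ hammingNorm v = w} := by
        refine ⟨_, ?_, ?_, rfl⟩
        · rw [hmem]; simp
        · intro h
          simpa [h01] using congrFun h i0
      rw [h] at this
      exact this
    · rintro w ⟨v, hv, hv0, rfl⟩
      rw [hmem] at hv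
      by_contra! hlt
      have hpos := hammingNorm_pos_iff.2 hv0
      have h1 : (Finset.univ.filter fun i => v i ≠ 0).card = 1 := by
        unfold hammingNorm at hlt hpos
        omega
      obtain ⟨i, hi⟩ := Finset.card_eq_one.1 h1
      have hsum := Finset.sum_filter_ne_zero (s := Finset.univ) (f := v)
      rw [hi, hv, Finset.sum_singleton] at hsum
      have : i ∈ Finset.univ.filter fun i => v i ≠ 0 := by rw [hi]; simp
      exact (Finset.mem_filter.1 this).2 hsum

/-- index set of the basis of the function space -/
def idx (m ℓ : ℕ) : Finset (Σ _ : ℕ, ℕ) :=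
  (Finset.range m).sigma fun i => Finset.range (if i = m - 1 then ℓ + 1 else i + 1)

lemma idx_card {m ℓ : ℕ} (hm : 2 ≤ m) : (idx m ℓ).card = 1 + (m * (m - 1) / 2 + ℓ) := by
  unfold idx
  rw [Finset.card_sigma]
  obtain ⟨k, rfl⟩ : ∃ k, m = k + 1 := ⟨m - 1, by omega⟩
  rw [Finset.sum_range_succ]
  have h1 : ∑ x ∈ Finset.range k, (Finset.range (if x = k + 1 - 1 then ℓ + 1 else x + 1)).card
      = ∑ x ∈ Finset.range k, (x + 1) := by
    refine Finset.sum_congr rfl fun x hx => ?_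
    have := Finset.mem_range.1 hx
    rw [if_neg (by omega), Finset.card_range]
  have h2 : ∑ x ∈ Finset.range k, (x + 1) = ∑ x ∈ Finset.range (k + 1), x := by
    rw [Finset.sum_range_succ']; simp
  rw [h1, h2, Finset.sum_range_id]
  simp
  omega

/-- symmetric extension of a coefficient vector -/
def cext {F : Type*} [Field F] {m ℓ : ℕ} (c : idx m ℓ → F) (i j : ℕ) : F :=
  if h : (⟨max i j, min i j⟩ : Σ _ : ℕ, ℕ) ∈ idx m ℓ then c ⟨_, h⟩ else 0

lemma cext_symm {F : Type*} [Field F] {m ℓ : ℕ} (c : idx m ℓ → F) (i j : ℕ) :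
    cext c i j = cext c j i := by
  unfold cext
  simp only [max_comm i j, min_comm i j]

lemma cext_supp {F : Type*} [Field F] {m ℓ : ℕ} (hℓ : ℓ ≤ m - 1) (c : idx m ℓ → F) (i j : ℕ)
    (h : cext c i j ≠ 0) (hi : i = m - 1) : j ≤ ℓ := by
  unfold cext at h
  split_ifs at h with h1
  · simp only [idx, Finset.mem_sigma, Finset.mem_range] at h1
    split_ifs at h1 <;> omega
  · exact absurd rfl h

lemma cext_self {F : Type*} [Field F] {m ℓ : ℕ} (hℓ : ℓ ≤ m - 1) (c : idx m ℓ → F)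
    (p : idx m ℓ) : cext c p.1.1 p.1.2 = c p ∧ p.1.1 < m ∧ p.1.2 < m := by
  obtain ⟨⟨i, j⟩, hp⟩ := p
  have h1 := hp
  simp only [idx, Finset.mem_sigma, Finset.mem_range] at h1
  have hji : j ≤ i ∧ j < m := by split_ifs at h1 <;> omega
  refine ⟨?_, h1.1, hji.2⟩
  unfold cext
  simp only [max_eq_left hji.1, min_eq_right hji.1]
  rw [dif_pos hp]

/-- the polynomial of a coefficient vector, linearly -/
noncomputable def Lpoly (F : Type*) [Field F] (q m ℓ : ℕ) : (idx m ℓ → F) →ₗ[F] F[X] where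
  toFun c := fpoly q m (cext c)
  map_add' c d := by
    simp only [fpoly, ← Finset.sum_add_distrib]
    refine Finset.sum_congr rfl fun i _ => Finset.sum_congr rfl fun j _ => ?_
    rw [← map_add]
    congr 1
    unfold cext
    split_ifs <;> simp
  map_smul' a c := by
    simp only [fpoly, Finset.smul_sum]
    refine Finset.sum_congr rfl fun i _ => Finset.sum_congr rfl fun j _ => ?_
    rw [← map_smul]
    congr 1
    unfold cext
    split_ifs <;> simp

lemma Lpoly_ne {F : Type*} [Field F] {q m ℓ : ℕ} (hmq : m ≤ q) (hℓ : ℓ ≤ m - 1)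
    {c : idx m ℓ → F} (hc : c ≠ 0) : fpoly q m (cext c) ≠ 0 := by
  obtain ⟨p, hp⟩ := Function.ne_iff.1 hc
  intro h
  obtain ⟨h1, h2, h3⟩ := cext_self hℓ c p
  have := fpoly_coeff (q := q) (c := cext c) hmq h2 h3
  rw [h, h1, coeff_zero] at this
  exact hp this.symm

lemma Lpoly_one {F : Type*} [Field F] {q m ℓ : ℕ} (hm : 2 ≤ m) :
    ∃ c : idx m ℓ → F, fpoly q m (cext c) = 1 := by
  refine ⟨fun p => if p.1 = ⟨0, 0⟩ then 1 else 0, ?_⟩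
  have h : ∀ i j, cext (fun p : idx m ℓ => if p.1 = ⟨0, 0⟩ then (1 : F) else 0) i j =
      if i = 0 ∧ j = 0 then 1 else 0 := by
    intro i j
    unfold cext
    by_cases hij : i = 0 ∧ j = 0
    · obtain ⟨rfl, rfl⟩ := hij
      rw [dif_pos]
      · simp
      · simp only [idx, Finset.mem_sigma, Finset.mem_range]
        split_ifs <;> simp <;> omega
    · rw [if_neg hij]
      by_cases h1 : (⟨max i j, min i j⟩ : Σ _ : ℕ, ℕ) ∈ idx m ℓ
      · rw [dif_pos h1]
        apply if_neg
        intro h2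
        simp only [Sigma.mk.injEq, heq_eq_eq] at h2
        omega
      · rw [dif_neg h1]
  unfold fpoly
  rw [Finset.sum_eq_single 0, Finset.sum_eq_single 0]
  · rw [h]; simp
  · intro b _ hb
    rw [h]; simp [hb]
  · simp; omega
  · intro b _ hb
    apply Finset.sum_eq_zero
    intro j _
    rw [h]; simp [hb]
  · simp; omega

end final

/-- For `0 ≤ t ≤ q`, `2 ≤ m ≤ q−1`, `0 ≤ ℓ ≤ m−1` and `n = t + (q²−q)/2`, there exist
`F_q`-linear codes `D ⊆ C` of length `n` with `dim C − dim D = m(m−1)/2 + ℓ`, with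
`d(D^⊥) = 2`, and with the minimum distance of `C` at least the designed distance
`δ`.  (By the CSS construction this yields a pure asymmetric quantum code with
parameters `[[n, m(m−1)/2 + ℓ, {d_z ≥ δ, d_x = 2}]]_q`.) -/
theorem statement14 {q t m ℓ : ℕ}
    (hq : ∃ p e : ℕ, p.Prime ∧ 0 < e ∧ q = p ^ e)
    (ht : t ≤ q) (hm2 : 2 ≤ m) (hmq : m ≤ q - 1) (hℓ : ℓ ≤ m - 1)
    (F : Type*) [Field F] [Fintype F] [DecidableEq F] (hF : Fintype.card F = q)
    (n : ℕ) (hn : n = t + (q ^ 2 - q) / 2)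
    (g : ℤ)
    (hg : g = if Odd q then min (max (2 * ((m : ℤ) - 2)) ((m : ℤ) + ℓ - 1)) (t : ℤ)
      else if ℓ ≤ m - 2 then max (min ((m : ℤ) - 2) (t : ℤ)) (2 * (t : ℤ) - q)
      else max (min ((m : ℤ) - 1) (t : ℤ)) (2 * (t : ℤ) - q))
    (δ : ℚ)
    (hδ : δ = (n : ℚ) - ((q : ℚ) * ((m : ℚ) - 1) + (ℓ : ℚ) + (g : ℚ)) / 2) :
    ∃ D C : Submodule F (Fin n → F), D ≤ C ∧
      Module.finrank F C = Module.finrank F D + (m * (m - 1) / 2 + ℓ) ∧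
      minDist (dualCode D) = 2 ∧
      ∀ v ∈ C, v ≠ 0 → δ ≤ (hammingNorm v : ℚ) := by
  classical
  have hq3 : 3 ≤ q := by omega
  obtain ⟨p, hp⟩ := CharP.exists F
  haveI : Fact p.Prime := ⟨CharP.char_is_prime F p⟩
  letI : Fintype (FiniteField.Extension F p 2) := Fintype.ofFinite _
  obtain ⟨K, _, _, _, hK⟩ : ∃ (K : Type) (_ : Field K) (_ : Fintype K) (_ : Algebra F K),
      Fintype.card K = q ^ 2 := by
    refine ⟨FiniteField.Extension F p 2, inferInstance, inferInstance, inferInstance, ?_⟩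
    rw [← Nat.card_eq_fintype_card, FiniteField.natCard_extension, Nat.card_eq_fintype_card, hF]
  obtain ⟨B, hBc, hB1, hB2⟩ := exists_B hF hK
  obtain ⟨T, -, hT⟩ := Finset.exists_subset_card_eq (s := (Finset.univ : Finset F)) (n := t)
    (by rw [Finset.card_univ, hF]; exact ht)
  have hnB : n = t + B.card := by omega
  have hn2 : 2 ≤ n := by
    have : 3 * q ≤ q ^ 2 := by rw [pow_two]; exact Nat.mul_le_mul_right _ hq3
    omega
  have hcard : Fintype.card (T ⊕ B) = n := by
    rw [Fintype.card_sum, Fintype.card_coe, Fintype.card_coe, hT, hnB]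
  let e : Fin n ≃ T ⊕ B := (Fintype.equivFinOfCardEq hcard).symm
  let pt : T ⊕ B → K := Sum.elim (fun a => algebraMap F K a) (fun b => b)
  obtain ⟨π, hπ⟩ := LinearMap.exists_leftInverse_of_injective (Algebra.linearMap F K)
    (LinearMap.ker_eq_bot.2 (algebraMap F K).injective)
  have hπ' : ∀ a : F, π (algebraMap F K a) = a := fun a => LinearMap.congr_fun hπ a
  let L : (idx m ℓ → F) →ₗ[F] (Fin n → F) :=
    LinearMap.pi fun i => π ∘ₗ (Polynomial.aeval (pt (e i))).toLinearMap ∘ₗ Lpoly F q m ℓ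
  have hL : ∀ c i, L c i = π (Polynomial.aeval (pt (e i)) (fpoly q m (cext c))) := fun c i => rfl
  have hL0 : ∀ c i, L c i = 0 ↔ Polynomial.aeval (pt (e i)) (fpoly q m (cext c)) = 0 := by
    intro c i
    rw [hL]
    obtain ⟨a, ha⟩ := fpoly_mem (m := m) hF hK (cext_symm c) (pt (e i))
    rw [← ha, hπ', map_eq_zero]
  have hinj : Function.Injective L := by
    rw [← LinearMap.ker_eq_bot, LinearMap.ker_eq_bot']
    intro c hc
    by_contra hne
    have hf := Lpoly_ne (q := q) (by omega) hℓ hne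
    have h1 := (pair_count hF hK (cext_symm c) hf ∅ (by simp) B hB1 hB2 (by
      intro b hb
      have := (hL0 c (e.symm (Sum.inr ⟨b, hb⟩))).1 (by rw [hc]; rfl)
      simpa [pt] using this)).1.trans (fpoly_natDegree (by omega) (cext_supp hℓ c))
    have h2 : q * (m - 1) ≤ q * (q - 2) := Nat.mul_le_mul_left _ (by omega)
    have h3 : q * (q - 2) + 2 * q = q ^ 2 := by
      obtain ⟨k, rfl⟩ : ∃ k, q = k + 2 := ⟨q - 2, by omega⟩
      simp; ring
    simp at h1
    omega
  refine ⟨Submodule.span F {(fun _ => 1)}, LinearMap.range L, ?_, ?_, dual_one hn2, ?_⟩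
  · rw [Submodule.span_singleton_le_iff_mem]
    obtain ⟨c, hc⟩ := Lpoly_one (F := F) (q := q) (ℓ := ℓ) hm2
    refine ⟨c, ?_⟩
    ext i
    rw [hL, hc, map_one, ← map_one (algebraMap F K), hπ']
  · rw [LinearMap.finrank_range_of_inj hinj, finrank_span_singleton]
    · rw [Module.finrank_fintype_fun_eq_card, Fintype.card_coe, idx_card hm2]
    · intro h
      simpa using congrFun h ⟨0, by omega⟩
  · rintro v ⟨c, rfl⟩ hv
    have hne : c ≠ 0 := by
      rintro rfl
      exact hv (map_zero L)
    have hf := Lpoly_ne (q := q) (by omega) hℓ hne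
    have hmain := main_count hm2 hmq hF hK (cext_symm c) (cext_supp hℓ c) hf T hT B hB1 hB2 g hg
    have hz : (Finset.univ.filter fun i => L c i = 0).card =
        (T.filter fun a => Polynomial.eval a (fpoly q m (cext c)) = 0).card +
        (B.filter fun b => Polynomial.aeval b (fpoly q m (cext c)) = 0).card := by
      simp only [hL0, Finset.card_filter]
      rw [Equiv.sum_comp e (fun x => if Polynomial.aeval (pt x) (fpoly q m (cext c)) = 0
        then 1 else 0), Fintype.sum_sum_type]
      congr 1
      · rw [← Finset.sum_coe_sort T]
        refine Finset.sum_congr rfl fun a _ => ?_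
        simp [pt, Polynomial.aeval_algebraMap_apply]
      · rw [← Finset.sum_coe_sort B]
        rfl
    have hw : (Finset.univ.filter fun i => L c i = 0).card + hammingNorm (L c) = n := by
      unfold hammingNorm
      rw [Finset.card_filter_add_card_filter_not, Finset.card_univ, Fintype.card_fin]
    rw [← hw, hz] at hδ
    have hmainQ : (2 : ℚ) *
        (((T.filter fun a => Polynomial.eval a (fpoly q m (cext c)) = 0).card : ℚ) +
        (B.filter fun b => Polynomial.aeval b (fpoly q m (cext c)) = 0).card) ≤
        q * (m - 1) + ℓ + g := by exact_mod_cast hmain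
    rw [hδ]
    push_cast
    linarith
end

section
/- Let q be a prime power and suppose either (q = 4, 1 ≤ t ≤ 4, m = 3, 0 ≤ ℓ ≤ 2) or (q ≥ 5, 0 ≤ t ≤ q, 3 ≤ m ≤ q−1, 0 ≤ ℓ ≤ m−1). Set n = t + (q²−q)/2. Then there exist F_q-linear codes D ⊆ C of length n such that: dim(C) − dim(D) = m(m−1)/2 + ℓ − 2; the minimum distance of the Euclidean dual D^⊥ equals 3; and the minimum distance of C is at least the designed distance δ. (Equivalently, by the CSS construction applied to the nested pair D = C_q(t,2,1) ⊆ C_q(t,m,ℓ) = C, there exists a pure asymmetric quantum CSS code with parameters [[n, m(m−1)/2 + ℓ − 2, {d_z ≥ δ, d_x = 3}]]_q.) -/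
set_option linter.unusedSimpArgs false
open Polynomial in
lemma aux_frob {F : Type*} [Field F] [Fintype F] {L : Type*} [Field L] [Algebra F L] (x : L)
    (hx : x ^ Fintype.card F = x) : ∃ a : F, algebraMap F L a = x := by
  have h1 : (X ^ Fintype.card F - X : F[X]) = ∏ a : F, (X - C a) := by
    have hc : 1 < Fintype.card F := Fintype.one_lt_card
    have hm : (X ^ Fintype.card F - X : F[X]).Monic := by
      apply monic_X_pow_sub
      rw [degree_X]; exact_mod_cast hc
    have := prod_multiset_X_sub_C_of_monic_of_roots_card_eq hm (by
      rw [FiniteField.roots_X_pow_card_sub_X, FiniteField.X_pow_card_sub_X_natDegree_eq F hc]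
      rfl)
    rw [← this, FiniteField.roots_X_pow_card_sub_X]
    rfl
  have h2 : aeval x (X ^ Fintype.card F - X : F[X]) = 0 := by simp [hx]
  rw [h1, map_prod, Finset.prod_eq_zero_iff] at h2
  obtain ⟨a, -, ha⟩ := h2
  refine ⟨a, ?_⟩
  simp [sub_eq_zero] at ha
  exact ha.symm

/-- index set of monomials -/
def Tset (m l : ℕ) : Finset (ℕ × ℕ) :=
  (Finset.range (m - 1)).biUnion Finset.HasAntidiagonal.antidiagonal ∪
    (Finset.range (l + 1)).image (fun j => (m - 1 - j, j))

lemma mem_Tset {m l : ℕ} (hl : l ≤ m - 1) (x : ℕ × ℕ) : x ∈ Tset m l ↔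
    x.1 + x.2 < m - 1 ∨ (x.1 + x.2 = m - 1 ∧ x.2 ≤ l) := by
  obtain ⟨i, j⟩ := x
  simp only [Tset, Finset.mem_union, Finset.mem_biUnion, Finset.mem_range, Finset.HasAntidiagonal.mem_antidiagonal,
    Finset.mem_image, Prod.mk.injEq]
  constructor
  · rintro (⟨a, h1, h2⟩ | ⟨a, h1, h2, h3⟩)
    · left; omega
    · right; omega
  · rintro (h | h)
    · left; exact ⟨_, h, rfl⟩
    · right; exact ⟨j, by omega, by omega, rfl⟩

lemma card_Tset {m l : ℕ} (hl : l ≤ m - 1) : (Tset m l).card = m * (m - 1) / 2 + l + 1 := by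
  rw [Tset, Finset.card_union_of_disjoint, Finset.card_biUnion, Finset.card_image_of_injective]
  · simp only [Finset.Nat.card_antidiagonal, Finset.card_range]
    have h : ∑ k ∈ Finset.range (m - 1), (k + 1) = m * (m - 1) / 2 := by
      rcases m with _ | m
      · simp
      · rw [← Finset.sum_range_id, Finset.sum_range_succ']; simp
    rw [h]; ring
  · intro a b h; simp at h; exact h.2
  · intro a _ b _ hab
    rw [Function.onFun, Finset.disjoint_left]
    intro x hx hy
    simp at hx hy; omega
  · rw [Finset.disjoint_left]
    intro x hx hy
    simp at hx hy
    obtain ⟨a, ha, rfl⟩ := hy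
    simp at hx; omega

/-- value of the polynomial with coefficients c at the point -/
def fval {F : Type*} [Field F] (T : Finset (ℕ × ℕ)) (c : ℕ × ℕ → F) (x : F × F) : F :=
  ∑ k ∈ T, c k * (x.1 ^ k.1 * x.2 ^ k.2)

open Polynomial in
noncomputable def Fpoly {F : Type*} [Field F] (q : ℕ) (T : Finset (ℕ × ℕ)) (c : ℕ × ℕ → F) : F[X] :=
  ∑ k ∈ T, C (c k) * ((X ^ q + X) ^ k.1 * (X ^ (q + 1)) ^ k.2)

open Polynomial in
noncomputable def Gpoly {F : Type*} [Field F] (T : Finset (ℕ × ℕ)) (c : ℕ × ℕ → F) : F[X] :=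
  ∑ k ∈ T, C (c k) * ((C 2 * X) ^ k.1 * (X ^ 2) ^ k.2)

open Polynomial in
lemma mono_aux {F : Type*} [Field F] {q : ℕ} (hq : 1 < q) (k : ℕ × ℕ) :
    ((X ^ q + X : F[X]) ^ k.1 * (X ^ (q + 1)) ^ k.2).Monic ∧
    ((X ^ q + X : F[X]) ^ k.1 * (X ^ (q + 1)) ^ k.2).natDegree = q * (k.1 + k.2) + k.2 := by
  have h1 : (X ^ q + X : F[X]).Monic := by
    apply monic_X_pow_add; rw [degree_X]; exact_mod_cast hq
  have h2 : (X ^ q + X : F[X]).natDegree = q := by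
    rw [natDegree_add_eq_left_of_natDegree_lt] <;> simp [hq]
  have h3 : ((X : F[X]) ^ (q + 1)).Monic := monic_X_pow _
  refine ⟨(h1.pow _).mul (h3.pow _), ?_⟩
  rw [(h1.pow _).natDegree_mul (h3.pow _), h1.natDegree_pow, h3.natDegree_pow, h2, natDegree_X_pow]
  ring

open Polynomial in
lemma Fpoly_ne {F : Type*} [Field F] {q m l : ℕ} (hq : 1 < q) (hm : m ≤ q - 1) (hl : l ≤ m - 1)
    (c : ℕ × ℕ → F) (hc : ∃ k ∈ Tset m l, c k ≠ 0) : Fpoly q (Tset m l) c ≠ 0 := by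
  classical
  obtain ⟨k, hk, hmax⟩ := Finset.exists_max_image ((Tset m l).filter (fun k => c k ≠ 0))
    (fun k => q * (k.1 + k.2) + k.2) (by
      obtain ⟨k, h1, h2⟩ := hc
      exact ⟨k, by simp [h1, h2]⟩)
  simp only [Finset.mem_filter] at hk hmax
  intro h0
  have h1 : (Fpoly q (Tset m l) c).coeff (q * (k.1 + k.2) + k.2) = c k := by
    rw [Fpoly, finsetSum_coeff, Finset.sum_eq_single k]
    · rw [coeff_C_mul, ← (mono_aux (F := F) hq k).2, coeff_natDegree, (mono_aux (F := F) hq k).1, mul_one]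
    · intro b hb hbk
      by_cases hcb : c b = 0
      · simp [hcb]
      rw [coeff_C_mul, coeff_eq_zero_of_natDegree_lt, mul_zero]
      rw [(mono_aux hq b).2]
      have h2 := hmax b ⟨hb, hcb⟩
      refine lt_of_le_of_ne h2 ?_
      intro h3
      apply hbk
      rw [mem_Tset hl] at hb hk
      have hbq : b.2 < q := by omega
      have hkq : k.2 < q := by have := hk.1; omega
      have h4 : b.2 = k.2 := by
        have := congrArg (· % q) h3
        simpa [Nat.mod_eq_of_lt hbq, Nat.mod_eq_of_lt hkq] using this
      have h5 : b.1 + b.2 = k.1 + k.2 := by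
        rw [h4] at h3
        have := Nat.add_right_cancel h3
        rw [h4]
        exact Nat.eq_of_mul_eq_mul_left (by omega) this
      ext <;> omega
    · intro h; exact absurd hk.1 h
  rw [h0] at h1
  exact hk.2 (by simpa using h1.symm)

open Polynomial in
lemma Fpoly_deg {F : Type*} [Field F] {q m l : ℕ} (hq : 1 < q) (hm3 : 2 ≤ m) (hm : m ≤ q - 1)
    (hl : l ≤ m - 1) (c : ℕ × ℕ → F) : (Fpoly q (Tset m l) c).natDegree ≤ q * (m - 1) + l := by
  apply natDegree_sum_le_of_forall_le
  intro k hk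
  refine (natDegree_C_mul_le _ _).trans ?_
  rw [(mono_aux hq k).2]
  rw [mem_Tset hl] at hk
  rcases hk with h | ⟨h, h'⟩
  · have : q * (k.1 + k.2 + 1) ≤ q * (m - 1) := Nat.mul_le_mul_left _ h
    rw [mul_add] at this
    omega
  · rw [h]; omega

open Polynomial in
lemma coprime_aux {F : Type*} [Field F] {p r : F[X]} (hp : p.Monic) (hr : r.Monic)
    (ip : Irreducible p) (ir : Irreducible r) (h : p ≠ r) : IsCoprime p r := by
  rw [ip.coprime_iff_not_dvd]
  intro hd
  exact h (eq_of_monic_of_associated hp hr (ip.associated_of_dvd ir hd))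

open Polynomial in
noncomputable def Qp {F : Type*} [Field F] (x : F × F) : F[X] := X ^ 2 - C x.1 * X + C x.2

open Polynomial in
lemma Qp_deg {F : Type*} [Field F] (x : F × F) : (Qp x).natDegree = 2 := by
  unfold Qp; compute_degree!

open Polynomial in
lemma Qp_monic {F : Type*} [Field F] (x : F × F) : (Qp x).Monic := by
  unfold Qp; monicity!

open Polynomial in
lemma Qp_inj {F : Type*} [Field F] {x y : F × F} (h : Qp x = Qp y) : x = y := by
  have h0 := congrArg (eval 0) h
  have h1 := congrArg (eval 1) h
  simp [Qp] at h0 h1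
  ext
  · rw [h0] at h1; simpa using h1
  · exact h0

open Polynomial in
lemma Qp_irr {F : Type*} [Field F] {x : F × F} (hx : ∀ a : F, a ^ 2 - x.1 * a + x.2 ≠ 0) :
    Irreducible (Qp x) := by
  rw [(Qp_monic x).irreducible_iff_roots_eq_zero_of_degree_le_three (by rw [Qp_deg])
    (by rw [Qp_deg]; norm_num)]
  rw [Multiset.eq_zero_iff_forall_notMem]
  intro a ha
  rw [mem_roots (Qp_monic x).ne_zero] at ha
  exact hx a (by simpa [Qp] using ha)

open Polynomial in
lemma Qp_dvd {F : Type*} [Field F] [Fintype F] {x : F × F} {T : Finset (ℕ × ℕ)} {c : ℕ × ℕ → F}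
    (hx : ∀ a : F, a ^ 2 - x.1 * a + x.2 ≠ 0) (h0 : fval T c x = 0) :
    Qp x ∣ Fpoly (Fintype.card F) T c := by
  let L := AlgebraicClosure F
  obtain ⟨α, hα⟩ := IsAlgClosed.exists_aeval_eq_zero L (Qp x) (by
    rw [degree_eq_natDegree (Qp_monic x).ne_zero, Qp_deg]; norm_num)
  have hα' : aeval (α ^ Fintype.card F) (Qp x) = 0 := by
    rw [← expand_aeval, FiniteField.expand_card, map_pow, hα, zero_pow Fintype.card_ne_zero]
  have hne : α ^ Fintype.card F ≠ α := by
    intro h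
    obtain ⟨a, ha⟩ := aux_frob α h
    apply hx a
    rw [← ha] at hα
    apply (algebraMap F L).injective
    simpa [Qp] using hα
  set β := α ^ Fintype.card F with hβ
  simp only [Qp, map_add, map_sub, map_mul, map_pow, aeval_X, aeval_C] at hα hα'
  have hs : β + α = algebraMap F L x.1 := by
    have : (β - α) * (β + α - algebraMap F L x.1) = 0 := by linear_combination hα' - hα
    rcases mul_eq_zero.1 this with h | h
    · exact absurd (sub_eq_zero.1 h) hne
    · exact sub_eq_zero.1 h
  have hp : β * α = algebraMap F L x.2 := by
    linear_combination α * hs - hα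
  have hm : Qp x = minpoly F α := by
    apply minpoly.eq_of_irreducible_of_monic (Qp_irr hx) _ (Qp_monic x)
    simpa [Qp] using hα
  rw [hm]
  apply minpoly.dvd
  have : aeval α (Fpoly (Fintype.card F) T c) = algebraMap F L (fval T c x) := by
    simp only [Fpoly, fval, map_sum, map_mul, map_pow, map_add, aeval_C, aeval_X]
    rw [pow_succ, ← hβ, hs, hp]
  rw [this, h0, map_zero]

open Polynomial in
lemma count_aux {F : Type*} [Field F] [Fintype F] {T : Finset (ℕ × ℕ)} {c : ℕ × ℕ → F}
    (Z : Finset (F × F)) (B : Finset F) (e : ℕ)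
    (hZ : ∀ x ∈ Z, (∀ a : F, a ^ 2 - x.1 * a + x.2 ≠ 0) ∧ fval T c x = 0)
    (hB : ∀ a ∈ B, (X - C a) ^ e ∣ Fpoly (Fintype.card F) T c)
    (h0 : Fpoly (Fintype.card F) T c ≠ 0) :
    2 * Z.card + e * B.card ≤ (Fpoly (Fintype.card F) T c).natDegree := by
  have h1 : ∏ x ∈ Z, Qp x ∣ Fpoly (Fintype.card F) T c := by
    apply Finset.prod_dvd_of_coprime
    · intro x hx y hy hxy
      exact coprime_aux (Qp_monic x) (Qp_monic y) (Qp_irr (hZ x hx).1) (Qp_irr (hZ y hy).1)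
        (fun h => hxy (Qp_inj h))
    · intro x hx; exact Qp_dvd (hZ x hx).1 (hZ x hx).2
  have h2 : ∏ a ∈ B, (X - C a) ^ e ∣ Fpoly (Fintype.card F) T c := by
    apply Finset.prod_dvd_of_coprime
    · intro x hx y hy hxy
      apply IsCoprime.pow
      exact coprime_aux (monic_X_sub_C x) (monic_X_sub_C y) (irreducible_X_sub_C x)
        (irreducible_X_sub_C y) (fun h => hxy (by simpa using h))
    · exact hB
  have h3 : IsCoprime (∏ x ∈ Z, Qp x) (∏ a ∈ B, (X - C a) ^ e) := by
    apply IsCoprime.prod_left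
    intro x hx
    apply IsCoprime.prod_right
    intro a _
    apply IsCoprime.pow_right
    apply coprime_aux (Qp_monic x) (monic_X_sub_C a) (Qp_irr (hZ x hx).1) (irreducible_X_sub_C a)
    intro h
    have := congrArg natDegree h
    rw [Qp_deg, natDegree_X_sub_C] at this
    omega
  have h4 := natDegree_le_of_dvd (h3.mul_dvd h1 h2) h0
  have m1 : (∏ x ∈ Z, Qp x).Monic := monic_prod_of_monic _ _ (fun x _ => Qp_monic x)
  have m2 : (∏ a ∈ B, (X - C a) ^ e).Monic :=
    monic_prod_of_monic _ _ (fun a _ => (monic_X_sub_C a).pow e)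
  rw [m1.natDegree_mul m2, natDegree_prod_of_monic _ _ (fun x _ => Qp_monic x),
    natDegree_prod_of_monic _ _ (fun a _ => (monic_X_sub_C a).pow e)] at h4
  simp only [Qp_deg, (monic_X_sub_C _).natDegree_pow, natDegree_X_sub_C] at h4
  simp at h4
  linarith

open Polynomial in
lemma Fpoly_eval {F : Type*} [Field F] [Fintype F] (T : Finset (ℕ × ℕ)) (c : ℕ × ℕ → F) (a : F) :
    (Fpoly (Fintype.card F) T c).eval a = fval T c (2 * a, a ^ 2) := by
  simp only [Fpoly, fval, eval_finsetSum, eval_mul, eval_pow, eval_add, eval_X, eval_C, pow_succ,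
    FiniteField.pow_card]
  simp [two_mul]

open Polynomial in
lemma Gpoly_eval {F : Type*} [Field F] (T : Finset (ℕ × ℕ)) (c : ℕ × ℕ → F) (a : F) :
    (Gpoly T c).eval a = fval T c (2 * a, a ^ 2) := by
  simp [Gpoly, fval, eval_finsetSum]

open Polynomial in
lemma Fpoly_double {F : Type*} [Field F] [Fintype F] (h2 : (2 : F) ≠ 0) (T : Finset (ℕ × ℕ))
    (c : ℕ × ℕ → F) (hG : Gpoly T c = 0) (h0 : Fpoly (Fintype.card F) T c ≠ 0) (a : F) :
    (X - C a) ^ 2 ∣ Fpoly (Fintype.card F) T c := by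
  rw [← le_rootMultiplicity_iff h0]
  have := (one_lt_rootMultiplicity_iff_isRoot h0 (t := a)).2
  apply this
  constructor
  · rw [IsRoot, Fpoly_eval, ← Gpoly_eval, hG, eval_zero]
  · have h : 2 * eval a (derivative (Fpoly (Fintype.card F) T c)) = eval a (derivative (Gpoly T c)) := by
      simp only [Fpoly, Gpoly, derivative_sum, eval_finsetSum, Finset.mul_sum]
      apply Finset.sum_congr rfl
      intro k _
      simp only [derivative_mul, derivative_pow, derivative_add, derivative_X, derivative_C,
        eval_mul, eval_add, eval_pow, eval_X, eval_C, eval_natCast, Nat.cast_add, 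
        FiniteField.cast_card_eq_zero, FiniteField.pow_card, pow_succ, eval_one, eval_zero,
        Nat.cast_one, C_0, C_add, C_1, Nat.add_sub_cancel, derivative_X_pow, map_add, map_one]
      simp [pow_succ]
      ring
    rw [hG] at h
    simp at h
    exact h.resolve_left h2

lemma two_eq_zero_of_even {F : Type*} [Field F] [Fintype F] (h : ¬ Odd (Fintype.card F)) :
    (2 : F) = 0 := by
  rw [Nat.not_odd_iff_even, Nat.even_iff] at h
  have := FiniteField.even_card_iff_char_two.2 h
  have h2 := (ringChar.spec F 2).2 (by rw [this])
  exact_mod_cast h2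

lemma two_ne_zero_of_odd {F : Type*} [Field F] [Fintype F] (h : Odd (Fintype.card F)) :
    (2 : F) ≠ 0 := by
  apply Ring.two_ne_zero
  intro h2
  have := FiniteField.even_card_of_char_two h2
  rw [Nat.odd_iff] at h
  omega

lemma sq_inj_of_two {F : Type*} [Field F] (h2 : (2 : F) = 0) {a b : F} (h : a ^ 2 = b ^ 2) :
    a = b := by
  have : (a - b) ^ 2 = 0 := by linear_combination h - a * b * h2 + b ^ 2 * h2
  exact sub_eq_zero.1 (pow_eq_zero_iff (two_ne_zero) |>.1 this)

lemma diag_inj {F : Type*} [Field F] {a b : F}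
    (h : ((2 * a, a ^ 2) : F × F) = (2 * b, b ^ 2)) : a = b := by
  simp only [Prod.mk.injEq] at h
  by_cases h2 : (2 : F) = 0
  · exact sq_inj_of_two h2 h.2
  · exact mul_left_cancel₀ h2 h.1

open Polynomial in
lemma Gpoly_deg {F : Type*} [Field F] {m l : ℕ} (hm3 : 2 ≤ m) 
    (hl : l ≤ m - 1) (c : ℕ × ℕ → F) :
    (Gpoly (Tset m l) c).natDegree ≤ max (2 * (m - 2)) (m - 1 + l) := by
  apply natDegree_sum_le_of_forall_le
  intro k hk
  refine (natDegree_C_mul_le _ _).trans ?_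
  refine natDegree_mul_le.trans ?_
  have h1 : ((C (2 : F) * X) ^ k.1).natDegree ≤ k.1 := by
    refine natDegree_pow_le.trans ?_
    have := (natDegree_C_mul_le (2 : F) X).trans natDegree_X_le
    nlinarith
  have h2 : (((X : F[X]) ^ 2) ^ k.2).natDegree = 2 * k.2 := by simp [mul_comm]
  rw [h2]
  rw [mem_Tset hl] at hk
  rw [le_max_iff]
  omega

open Polynomial in
lemma core {F : Type*} [Field F] [Fintype F] [DecidableEq F] {q t m l : ℕ}
    (hF : Fintype.card F = q) (hq : 1 < q) (hm3 : 2 ≤ m) (hm : m ≤ q - 1) (hl : l ≤ m - 1)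
    (A : Finset F) (hA : A.card = t) (c : ℕ × ℕ → F) (hc : ∃ k ∈ Tset m l, c k ≠ 0)
    (Z : Finset (F × F)) (ZA : Finset F) (hZA : ZA ⊆ A)
    (hZ : ∀ x ∈ Z, (∀ a : F, a ^ 2 - x.1 * a + x.2 ≠ 0) ∧ fval (Tset m l) c x = 0)
    (hZA0 : ∀ a ∈ ZA, fval (Tset m l) c (2 * a, a ^ 2) = 0)
    (g : ℤ)
    (hg : g = if Odd q then min (max (2 * ((m : ℤ) - 2)) ((m : ℤ) + l - 1)) (t : ℤ)
      else if l ≤ m - 2 then max (min ((m : ℤ) - 2) (t : ℤ)) (2 * (t : ℤ) - q)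
      else max (min ((m : ℤ) - 1) (t : ℤ)) (2 * (t : ℤ) - q)) :
    g ≤ t ∧ 2 * ((Z.card : ℤ) + ZA.card) ≤ (q : ℤ) * (m - 1) + l + g := by
  have hAt : ZA.card ≤ t := hA ▸ Finset.card_le_card hZA
  have htq : t ≤ q := by rw [← hA, ← hF]; exact Finset.card_le_univ A
  subst hF
  have hne := Fpoly_ne hq hm hl c hc
  have hdeg := Fpoly_deg hq hm3 hm hl c
  have hcast : ((Fintype.card F * (m - 1) : ℕ) : ℤ) = (Fintype.card F : ℤ) * (m - 1) := by
    rw [Nat.cast_mul, Nat.cast_sub (by omega)]; simp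
  rw [← hcast]
  generalize hE : Fintype.card F * (m - 1) = E at *
  have single : ∀ B : Finset F, (∀ a ∈ B, fval (Tset m l) c (2 * a, a ^ 2) = 0) →
      2 * Z.card + B.card ≤ E + l := by
    intro B hB
    have := count_aux Z B 1 hZ (fun a ha => by
      rw [pow_one, dvd_iff_isRoot, IsRoot, Fpoly_eval]; exact hB a ha) hne
    omega
  have s1 := single ZA hZA0
  by_cases hodd : Odd (Fintype.card F)
  · rw [if_pos hodd] at hg
    by_cases hG : Gpoly (Tset m l) c = 0
    · have := count_aux Z Finset.univ 2 hZ
        (fun a _ => Fpoly_double (two_ne_zero_of_odd hodd) _ _ hG hne a) hne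
      rw [Finset.card_univ] at this
      omega
    · have h1 : ZA.card ≤ (Gpoly (Tset m l) c).natDegree := by
        apply card_le_degree_of_subset_roots
        intro a ha
        rw [mem_roots hG, IsRoot, Gpoly_eval]
        exact hZA0 a ha
      have h2 := Gpoly_deg hm3 hl c
      omega
  · rw [if_neg hodd] at hg
    have h2 := two_eq_zero_of_even hodd
    let H : F[X] := ∑ k ∈ (Tset m l).filter (fun k => k.1 = 0), C (c k) * X ^ k.2
    have hH : ∀ a, fval (Tset m l) c (2 * a, a ^ 2) = H.eval (a ^ 2) := by
      intro a
      simp only [H, fval, eval_finsetSum, Finset.sum_filter]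
      apply Finset.sum_congr rfl
      intro k _
      by_cases h : k.1 = 0
      · simp [h]
      · simp [h, h2]
    by_cases hH0 : H = 0
    · have := single Finset.univ (fun a _ => by rw [hH, hH0, eval_zero])
      rw [Finset.card_univ] at this
      split_ifs at hg <;> omega
    · have h1 : ZA.card ≤ H.natDegree := by
        rw [← Finset.card_image_of_injective ZA
          (f := fun a : F => a ^ 2) (fun a b h => sq_inj_of_two h2 h)]
        apply card_le_degree_of_subset_roots
        intro b hb
        simp only [Finset.mem_val, Finset.mem_image] at hb
        obtain ⟨a, ha, rfl⟩ := hb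
        rw [mem_roots hH0, IsRoot, ← hH]
        exact hZA0 a ha
      have h3 : H.natDegree ≤ if l ≤ m - 2 then m - 2 else m - 1 := by
        apply natDegree_sum_le_of_forall_le
        intro k hk
        refine (natDegree_C_mul_X_pow_le _ _).trans ?_
        rw [Finset.mem_filter, mem_Tset hl] at hk
        split_ifs <;> omega
      split_ifs at hg h3 <;> omega

/-- points without roots -/
def Irr (F : Type*) [Field F] [Fintype F] [DecidableEq F] : Finset (F × F) :=
  Finset.univ.filter (fun x => ∀ a : F, a ^ 2 - x.1 * a + x.2 ≠ 0)

lemma card_Irr (F : Type*) [Field F] [Fintype F] [DecidableEq F] :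
    (Irr F).card = (Fintype.card F ^ 2 - Fintype.card F) / 2 := by
  let φ : Sym2 F → F × F := Sym2.lift ⟨fun a b => (a + b, a * b), fun a b => by
    simp [add_comm, mul_comm]⟩
  have hφ : Function.Injective φ := by
    intro x y
    induction x using Sym2.ind with | _ a b
    induction y using Sym2.ind with | _ u v
    intro h
    simp only [φ, Sym2.lift_mk, Prod.mk.injEq] at h
    have h3 : (a - u) * (a - v) = 0 := by linear_combination a * h.1 - h.2
    rw [Sym2.eq_iff]
    rcases mul_eq_zero.1 h3 with h3 | h3
    · left; refine ⟨sub_eq_zero.1 h3, ?_⟩; linear_combination h.1 - h3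
    · right; refine ⟨sub_eq_zero.1 h3, ?_⟩; linear_combination h.1 - h3
  have hc : (Irr F)ᶜ = Finset.univ.image φ := by
    ext ⟨s, p⟩
    simp only [Irr, Finset.compl_filter, Finset.mem_filter, Finset.mem_univ, true_and,
      Finset.mem_image]
    push Not
    constructor
    · rintro ⟨a, ha⟩
      refine ⟨s(a, s - a), ?_⟩
      simp only [φ, Sym2.lift_mk, Prod.mk.injEq]
      constructor
      · ring
      · linear_combination -ha
    · rintro ⟨x, hx⟩
      induction x using Sym2.ind with | _ a b
      simp only [φ, Sym2.lift_mk, Prod.mk.injEq] at hx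
      refine ⟨a, ?_⟩
      rw [← hx.1, ← hx.2]; ring
  have h1 := Finset.card_add_card_compl (Irr F)
  rw [hc, Finset.card_image_of_injective _ hφ, Finset.card_univ, Sym2.card, Fintype.card_prod,
    Nat.choose_two_right] at h1
  simp only [Nat.add_sub_cancel] at h1
  generalize Fintype.card F = q at *
  have e1 : (q + 1) * q / 2 * 2 = (q + 1) * q :=
    Nat.div_mul_cancel (by simpa [mul_comm] using (Nat.even_mul_succ_self q).two_dvd)
  have e2 : q ^ 2 - q = 2 * (Irr F).card := by
    have : q ^ 2 = 2 * (Irr F).card + q := by nlinarith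
    omega
  omega

lemma mem_dual_span {F : Type*} [Field F] {n : ℕ} (S : Set (Fin n → F)) (u : Fin n → F) :
    u ∈ dualCode (Submodule.span F S) ↔ ∀ v ∈ S, ∑ i, u i * v i = 0 := by
  constructor
  · intro h v hv
    exact h v (Submodule.subset_span hv)
  · intro h v hv
    induction hv using Submodule.span_induction with
    | mem x hx => exact h x hx
    | zero => simp
    | add x y _ _ hx hy => simp [mul_add, Finset.sum_add_distrib, hx, hy]
    | smul a x _ hx =>
      have : ∑ i, u i * (a • x) i = a * ∑ i, u i * x i := by
        rw [Finset.mul_sum]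
        apply Finset.sum_congr rfl
        intro i _
        simp only [Pi.smul_apply, smul_eq_mul]; ring
      rw [this, hx, mul_zero]

/-- evaluation vector of a monomial -/
def phi {F : Type*} [Field F] {n : ℕ} (pt : Fin n → F × F) (k : ℕ × ℕ) : Fin n → F :=
  fun i => (pt i).1 ^ k.1 * (pt i).2 ^ k.2

lemma mem_dual_D {F : Type*} [Field F] {n : ℕ} (pt : Fin n → F × F) (u : Fin n → F) :
    u ∈ dualCode (Submodule.span F (phi pt '' (Tset 2 1 : Set (ℕ × ℕ)))) ↔
      ∑ i, u i = 0 ∧ ∑ i, u i * (pt i).1 = 0 ∧ ∑ i, u i * (pt i).2 = 0 := by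
  have hT : Tset 2 1 = {(0, 0), (1, 0), (0, 1)} := by decide
  rw [mem_dual_span, hT, Set.forall_mem_image]
  simp [phi]

lemma dual_ge {F : Type*} [Field F] [DecidableEq F] {n : ℕ} (pt : Fin n → F × F)
    (hpt : Function.Injective pt) (u : Fin n → F)
    (hu : u ∈ dualCode (Submodule.span F (phi pt '' (Tset 2 1 : Set (ℕ × ℕ))))) (h0 : u ≠ 0) :
    3 ≤ hammingNorm u := by
  rw [mem_dual_D] at hu
  obtain ⟨h1, h2, h3⟩ := hu
  by_contra hlt
  have key : ∀ w : Fin n → F, ∑ i, u i * w i = ∑ i ∈ Finset.univ.filter (fun i => u i ≠ 0), u i * w i := by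
    intro w
    rw [Finset.sum_filter]
    apply Finset.sum_congr rfl
    intro i _
    by_cases h : u i = 0 <;> simp [h]
  have h1' : ∑ i, u i * (fun _ => (1 : F)) i = 0 := by simpa using h1
  rw [key] at h1' h2 h3
  have hcard : (Finset.univ.filter (fun i => u i ≠ 0)).card < 3 := by
    simpa [hammingNorm] using hlt
  have hmem : ∀ i, i ∈ Finset.univ.filter (fun i => u i ≠ 0) ↔ u i ≠ 0 := by simp
  generalize Finset.univ.filter (fun i => u i ≠ 0) = S at *
  interval_cases hS : S.card
  · rw [Finset.card_eq_zero] at hS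
    subst hS
    apply h0
    ext i
    simpa using hmem i
  · rw [Finset.card_eq_one] at hS
    obtain ⟨i, rfl⟩ := hS
    simp at h1'
    exact (hmem i).1 (by simp) h1'
  · rw [Finset.card_eq_two] at hS
    obtain ⟨i, j, hij, rfl⟩ := hS
    have hi := (hmem i).1 (by simp)
    rw [Finset.sum_pair hij] at h1' h2 h3
    apply hij
    apply hpt
    simp only [mul_one] at h1'
    have e1 : u i * ((pt i).1 - (pt j).1) = 0 := by linear_combination h2 - (pt j).1 * h1'
    have e2 : u i * ((pt i).2 - (pt j).2) = 0 := by linear_combination h3 - (pt j).2 * h1'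
    have e1' := (mul_eq_zero.1 e1).resolve_left hi
    have e2' := (mul_eq_zero.1 e2).resolve_left hi
    ext
    · exact sub_eq_zero.1 e1'
    · exact sub_eq_zero.1 e2'

lemma dual_mk {F : Type*} [Field F] [DecidableEq F] {n : ℕ} (pt : Fin n → F × F)
    (i j k : Fin n) (hij : i ≠ j) (hik : i ≠ k) (a b : F) (ha : a ≠ 0)
    (h1 : a * ((pt i).1 - (pt k).1) + b * ((pt j).1 - (pt k).1) = 0)
    (h2 : a * ((pt i).2 - (pt k).2) + b * ((pt j).2 - (pt k).2) = 0) :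
    ∃ u ∈ dualCode (Submodule.span F (phi pt '' (Tset 2 1 : Set (ℕ × ℕ)))),
      u ≠ 0 ∧ hammingNorm u ≤ 3 := by
  refine ⟨Pi.single i a + Pi.single j b + Pi.single k (-a - b), ?_, ?_, ?_⟩
  · rw [mem_dual_D]
    simp only [Pi.add_apply, add_mul, Finset.sum_add_distrib]
    simp only [Pi.single_apply, ite_mul, zero_mul, Finset.sum_ite_eq', Finset.mem_univ, if_true]
    refine ⟨by ring, by linear_combination h1, by linear_combination h2⟩
  · intro h
    have := congrFun h i
    simp [hij, hik] at this
    exact ha this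
  · have : (Finset.univ.filter (fun x => (Pi.single i a + Pi.single j b + Pi.single k (-a - b) : Fin n → F) x ≠ 0)) ⊆ {i, j, k} := by
      intro x hx
      by_contra hx'
      simp only [Finset.mem_insert, Finset.mem_singleton, not_or] at hx'
      simp [hx'] at hx
    exact (Finset.card_le_card this).trans Finset.card_le_three

lemma dual_le {F : Type*} [Field F] [Fintype F] [DecidableEq F] {n : ℕ} (pt : Fin n → F × F)
    (hpt : Function.Injective pt) (hn : Fintype.card F + 3 ≤ n) :
    ∃ u ∈ dualCode (Submodule.span F (phi pt '' (Tset 2 1 : Set (ℕ × ℕ)))),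
      u ≠ 0 ∧ hammingNorm u ≤ 3 := by
  let k : Fin n := ⟨0, by omega⟩
  obtain ⟨i, hi, j, hj, hij, h⟩ := Finset.exists_ne_map_eq_of_card_lt_of_maps_to
    (s := Finset.univ.erase k) (t := (Finset.univ : Finset (Option F)))
    (f := fun i => if (pt i).1 - (pt k).1 = 0 then none
      else some (((pt i).2 - (pt k).2) / ((pt i).1 - (pt k).1)))
    (by rw [Finset.card_univ, Fintype.card_option, Finset.card_erase_of_mem (Finset.mem_univ _)]
        simp; omega) (fun _ _ => by simp)
  have hi' : i ≠ k := by simpa using hi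
  have hj' : j ≠ k := by simpa using hj
  by_cases h1 : (pt i).1 - (pt k).1 = 0
  · have h2 : (pt j).1 - (pt k).1 = 0 := by
      by_contra h2
      simp [h1, h2] at h
    apply dual_mk pt i j k hij hi' ((pt j).2 - (pt k).2) (-((pt i).2 - (pt k).2))
    · intro h3
      apply hj'
      apply hpt
      ext
      · exact sub_eq_zero.1 h2
      · exact sub_eq_zero.1 h3
    · rw [h1, h2]; ring
    · ring
  · have h2 : (pt j).1 - (pt k).1 ≠ 0 := by
      intro h2
      simp [h1, h2] at h
    simp only [h1, h2, if_false, Option.some.injEq] at h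
    apply dual_mk pt i j k hij hi' ((pt j).1 - (pt k).1) (-((pt i).1 - (pt k).1)) h2
    · ring
    · rw [div_eq_div_iff h1 h2] at h
      linear_combination h

lemma dual_dist {F : Type*} [Field F] [Fintype F] [DecidableEq F] {n : ℕ} (pt : Fin n → F × F)
    (hpt : Function.Injective pt) (hn : Fintype.card F + 3 ≤ n) :
    minDist (dualCode (Submodule.span F (phi pt '' (Tset 2 1 : Set (ℕ × ℕ))))) = 3 := by
  obtain ⟨u, hu, hu0, hu3⟩ := dual_le pt hpt hn
  have h3 : hammingNorm u = 3 := le_antisymm hu3 (dual_ge pt hpt u hu hu0)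
  apply le_antisymm
  · exact Nat.sInf_le ⟨u, hu, hu0, h3⟩
  · refine le_csInf (Set.nonempty_of_mem (x := 3) ⟨u, hu, hu0, h3⟩) ?_
    rintro w ⟨v, hv, hv0, rfl⟩
    exact dual_ge pt hpt v hv hv0

lemma exists_pts {F : Type*} [Field F] [Fintype F] [DecidableEq F] (A : Finset F) (n : ℕ)
    (hn : n = A.card + (Fintype.card F ^ 2 - Fintype.card F) / 2) :
    ∃ pt : Fin n → F × F, Function.Injective pt ∧
      ∀ i, pt i ∈ Irr F ∪ A.image (fun a => (2 * a, a ^ 2)) := by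
  have hc : (Irr F ∪ A.image (fun a => (2 * a, a ^ 2))).card = n := by
    rw [Finset.card_union_of_disjoint, Finset.card_image_of_injective _ (fun a b h => diag_inj h),
      card_Irr, hn, add_comm]
    rw [Finset.disjoint_left]
    intro x hx hy
    simp only [Finset.mem_image] at hy
    obtain ⟨a, -, rfl⟩ := hy
    simp only [Irr, Finset.mem_filter] at hx
    exact hx.2 a (by ring)
  let e := (Finset.equivFinOfCardEq hc).symm
  exact ⟨fun i => (e i : F × F), fun i j h => e.injective (Subtype.ext h), fun i => (e i).2⟩

lemma weight {F : Type*} [Field F] [Fintype F] [DecidableEq F] {q t m l n : ℕ}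
    (hF : Fintype.card F = q) (hq : 1 < q) (hm3 : 2 ≤ m) (hm : m ≤ q - 1) (hl : l ≤ m - 1)
    (A : Finset F) (hA : A.card = t) (pt : Fin n → F × F) (hpt : Function.Injective pt)
    (hpt' : ∀ i, pt i ∈ Irr F ∪ A.image (fun a => (2 * a, a ^ 2)))
    (c : ℕ × ℕ → F) (hc : ∃ k ∈ Tset m l, c k ≠ 0)
    (g : ℤ)
    (hg : g = if Odd q then min (max (2 * ((m : ℤ) - 2)) ((m : ℤ) + l - 1)) (t : ℤ)
      else if l ≤ m - 2 then max (min ((m : ℤ) - 2) (t : ℤ)) (2 * (t : ℤ) - q)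
      else max (min ((m : ℤ) - 1) (t : ℤ)) (2 * (t : ℤ) - q)) :
    g ≤ t ∧ 2 * ((n : ℤ) - hammingNorm (∑ k ∈ Tset m l, c k • phi pt k)) ≤
      (q : ℤ) * (m - 1) + l + g := by
  have hv : ∀ i, (∑ k ∈ Tset m l, c k • phi pt k) i = fval (Tset m l) c (pt i) := by
    intro i
    simp [fval, phi, Finset.sum_apply]
  generalize (∑ k ∈ Tset m l, c k • phi pt k) = v at *
  let Z := (Irr F).filter (fun x => fval (Tset m l) c x = 0)
  let ZA := A.filter (fun a => fval (Tset m l) c (2 * a, a ^ 2) = 0)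
  obtain ⟨h1, h2⟩ := core hF hq hm3 hm hl A hA c hc Z ZA (Finset.filter_subset _ _)
    (fun x hx => by simpa [Z, Irr] using hx) (fun a ha => (Finset.mem_filter.1 ha).2) g hg
  refine ⟨h1, le_trans ?_ h2⟩
  have h3 : (Finset.univ.filter (fun i => v i = 0)).card ≤ Z.card + ZA.card := by
    rw [← Finset.card_image_of_injective _ hpt]
    have : (Finset.univ.filter (fun i => v i = 0)).image pt ⊆
        Z ∪ ZA.image (fun a => (2 * a, a ^ 2)) := by
      intro x hx
      simp only [Finset.mem_image, Finset.mem_filter, Finset.mem_univ, true_and] at hx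
      obtain ⟨i, hi, rfl⟩ := hx
      rw [hv] at hi
      have h := hpt' i
      rw [Finset.mem_union] at h ⊢
      rcases h with h | h
      · left; exact Finset.mem_filter.2 ⟨h, hi⟩
      · right
        obtain ⟨a, ha, hai⟩ := Finset.mem_image.1 h
        refine Finset.mem_image.2 ⟨a, Finset.mem_filter.2 ⟨ha, ?_⟩, hai⟩
        rw [hai]; exact hi
    refine (Finset.card_le_card this).trans ((Finset.card_union_le _ _).trans ?_)
    exact Nat.add_le_add_left Finset.card_image_le _
  have h4 : (Finset.univ.filter (fun i => v i = 0)).card + hammingNorm v = n := by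
    have := Finset.card_filter_add_card_filter_not (s := (Finset.univ : Finset (Fin n)))
      (fun i => v i = 0)
    simpa [hammingNorm] using this
  omega

/-- Suppose either `q = 4`, `1 ≤ t ≤ 4`, `m = 3`, `0 ≤ ℓ ≤ 2`, or `q ≥ 5`,
`0 ≤ t ≤ q`, `3 ≤ m ≤ q−1`, `0 ≤ ℓ ≤ m−1`; set `n = t + (q²−q)/2`.  Then there exist
`F_q`-linear codes `D ⊆ C` of length `n` with `dim C − dim D = m(m−1)/2 + ℓ − 2`,
with `d(D^⊥) = 3`, and with the minimum distance of `C` at least the designed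
distance `δ`.  (By the CSS construction this yields a pure asymmetric quantum code
with parameters `[[n, m(m−1)/2 + ℓ − 2, {d_z ≥ δ, d_x = 3}]]_q`.) -/
theorem statement15 {q t m ℓ : ℕ}
    (hq : ∃ p e : ℕ, p.Prime ∧ 0 < e ∧ q = p ^ e)
    (hcase : (q = 4 ∧ 1 ≤ t ∧ t ≤ 4 ∧ m = 3 ∧ ℓ ≤ 2) ∨
      (5 ≤ q ∧ t ≤ q ∧ 3 ≤ m ∧ m ≤ q - 1 ∧ ℓ ≤ m - 1))
    (F : Type*) [Field F] [Fintype F] [DecidableEq F] (hF : Fintype.card F = q)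
    (n : ℕ) (hn : n = t + (q ^ 2 - q) / 2)
    (g : ℤ)
    (hg : g = if Odd q then min (max (2 * ((m : ℤ) - 2)) ((m : ℤ) + ℓ - 1)) (t : ℤ)
      else if ℓ ≤ m - 2 then max (min ((m : ℤ) - 2) (t : ℤ)) (2 * (t : ℤ) - q)
      else max (min ((m : ℤ) - 1) (t : ℤ)) (2 * (t : ℤ) - q))
    (δ : ℚ)
    (hδ : δ = (n : ℚ) - ((q : ℚ) * ((m : ℚ) - 1) + (ℓ : ℚ) + (g : ℚ)) / 2) :
    ∃ D C : Submodule F (Fin n → F), D ≤ C ∧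
      Module.finrank F C = Module.finrank F D + (m * (m - 1) / 2 + ℓ - 2) ∧
      minDist (dualCode D) = 3 ∧
      ∀ v ∈ C, v ≠ 0 → δ ≤ (hammingNorm v : ℚ) := by
  have hq4 : 4 ≤ q := by omega
  have htq : t ≤ q := by omega
  have hm3 : 3 ≤ m := by omega
  have hm : m ≤ q - 1 := by omega
  have hl : ℓ ≤ m - 1 := by omega
  obtain ⟨A, -, hA⟩ := Finset.exists_subset_card_eq (s := (Finset.univ : Finset F)) (n := t)
    (by rw [Finset.card_univ, hF]; exact htq)
  obtain ⟨pt, hpt, hpt'⟩ := exists_pts A n (by rw [hA, hF]; exact hn)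
  have hev : 2 * ((q ^ 2 - q) / 2) = q ^ 2 - q := by
    apply Nat.mul_div_cancel'
    have : q ^ 2 - q = q * (q - 1) := by rw [Nat.mul_sub, pow_two, mul_one]
    rw [this]
    exact (Nat.even_mul_pred_self q).two_dvd
  have hle : q ≤ q ^ 2 := by nlinarith
  have h2n : 2 * (n : ℤ) = 2 * t + (q : ℤ) ^ 2 - q := by
    have : 2 * n + q = 2 * t + q ^ 2 := by omega
    zify at this
    linarith
  have hn3 : Fintype.card F + 3 ≤ n := by
    rw [hF]
    rcases hcase with h | h
    · obtain ⟨rfl, h, -⟩ := h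
      norm_num at hn; omega
    · have : (5 : ℤ) ≤ q := by exact_mod_cast h.1
      zify
      nlinarith
  have W := fun c hc => weight hF (by omega) (by omega) hm hl A hA pt hpt hpt' c hc g hg
  have hind : LinearIndepOn F (phi pt) (Tset m ℓ : Set (ℕ × ℕ)) := by
    rw [linearIndepOn_finset_iff]
    intro c h0
    by_contra hc
    push Not at hc
    obtain ⟨h1, h2⟩ := W c hc
    rw [h0, hammingNorm_zero] at h2
    have e1 : (q : ℤ) * (m - 1) ≤ q * (q - 2) :=
      mul_le_mul_of_nonneg_left (by omega) (by omega)
    have e2 : (ℓ : ℤ) ≤ q - 2 := by omega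
    push_cast at h2
    nlinarith
  have hsub : (Tset 2 1 : Set (ℕ × ℕ)) ⊆ Tset m ℓ := by
    intro x hx
    rw [Finset.mem_coe, mem_Tset (by omega)] at hx ⊢
    omega
  have hrank : ∀ T : Finset (ℕ × ℕ), LinearIndepOn F (phi pt) (T : Set (ℕ × ℕ)) →
      Module.finrank F (Submodule.span F (phi pt '' (T : Set (ℕ × ℕ)))) = T.card := by
    intro T hT
    have := finrank_span_eq_card (LinearIndepOn.linearIndependent hT)
    rw [Set.image_eq_range]
    simpa using this
  refine ⟨Submodule.span F (phi pt '' (Tset 2 1 : Set (ℕ × ℕ))),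
    Submodule.span F (phi pt '' (Tset m ℓ : Set (ℕ × ℕ))),
    Submodule.span_mono (Set.image_mono hsub), ?_, dual_dist pt hpt hn3, ?_⟩
  · rw [hrank _ hind, hrank _ (hind.mono hsub), card_Tset hl, card_Tset (by omega)]
    have : 3 ≤ m * (m - 1) / 2 := by
      rw [Nat.le_div_iff_mul_le (by norm_num)]
      exact Nat.mul_le_mul hm3 (by omega : 2 ≤ m - 1)
    omega
  · intro v hv hv0
    rw [Submodule.mem_span_image_finset_iff_exists_fun'] at hv
    obtain ⟨c, hcv⟩ := hv
    subst hcv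
    have hc : ∃ k ∈ Tset m ℓ, c k ≠ 0 := by
      by_contra h
      push Not at h
      apply hv0
      exact Finset.sum_eq_zero (fun k hk => by rw [h k hk, zero_smul])
    have h2 := (W c hc).2
    have h3 : 2 * ((n : ℚ) - hammingNorm (∑ k ∈ Tset m ℓ, c k • phi pt k)) ≤
      (q : ℚ) * (m - 1) + ℓ + g := by exact_mod_cast h2
    rw [hδ]
    linarith
end

section
/- Let q ≥ 5 be a prime power and let 0 ≤ t ≤ q, 5 ≤ m ≤ q−1, and 0 ≤ ℓ ≤ m−1 be integers. Set n = t + (q²−q)/2. Then there exist F_q-linear codes D ⊆ C of length n such that: dim(C) − dim(D) = m(m−1)/2 + ℓ − 7; the minimum distance of the Euclidean dual D^⊥ is at least 5; and the minimum distance of C is at least the designed distance δ. (Equivalently, by the CSS construction applied to the nested pair D = 𝓕 ⊆ C_q(t,m,ℓ) = C, where 𝓕 is the evaluation code of the span of {1, x^{q+1}, x^{2(q+1)}, x^{3(q+1)}, x^q+x, x^{2q}+x², x^{3q}+x³, x^{2q+1}+x^{q+2}}, there exists a pure asymmetric quantum CSS code with parameters [[n, m(m−1)/2 + ℓ − 7,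 {d_z ≥ δ, d_x ≥ 5}]]_q.) -/
open Polynomial in
/-- Evaluation of the bivariate polynomial `∑ c_{k,b} s^{k-b} p^b` in an algebra. -/
noncomputable def ev17 {F : Type*} [Field F] (I : Finset (Σ _ : ℕ, ℕ)) (c : (Σ _ : ℕ, ℕ) → F)
    {A : Type*} [CommRing A] [Algebra F A] (s p : A) : A :=
  ∑ x ∈ I, algebraMap F A (c x) * (s ^ (x.1 - x.2) * p ^ x.2)

section Helpers
open Polynomial

variable {F : Type*} [Field F]

lemma ev17_map (I : Finset (Σ _ : ℕ, ℕ)) (c : (Σ _ : ℕ, ℕ) → F)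
    {A B : Type*} [CommRing A] [Algebra F A] [CommRing B] [Algebra F B] (φ : A →ₐ[F] B) (s p : A) :
    φ (ev17 I c s p) = ev17 I c (φ s) (φ p) := by
  simp [ev17, map_sum]

lemma quad_natDegree (s p : F) : (X ^ 2 - C s * X + C p : F[X]).natDegree = 2 := by
  compute_degree!

lemma quad_monic (s p : F) : (X ^ 2 - C s * X + C p : F[X]).Monic := by
  monicity!

lemma quad_irred {s p : F} (h : ∀ x : F, x ^ 2 - s * x + p ≠ 0) :
    Irreducible (X ^ 2 - C s * X + C p : F[X]) := by
  apply irreducible_of_degree_le_three_of_not_isRoot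
  · rw [quad_natDegree]; simp
  · intro x hx
    apply h x
    simpa [IsRoot] using hx

lemma term_natDegree (q a b : ℕ) (hq : 2 ≤ q) :
    ((X ^ q + X : F[X]) ^ a * (X ^ (q + 1)) ^ b).natDegree = q * (a + b) + b ∧
    ((X ^ q + X : F[X]) ^ a * (X ^ (q + 1)) ^ b).Monic := by
  have hm : (X ^ q + X : F[X]).Monic := monic_X_pow_add (by
    rw [degree_X]; exact_mod_cast hq)
  have hd : (X ^ q + X : F[X]).natDegree = q := by
    rw [natDegree_add_eq_left_of_natDegree_lt] <;> simp; omega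
  refine ⟨?_, (hm.pow a).mul ((monic_X_pow _).pow b)⟩
  rw [Monic.natDegree_mul (hm.pow a) ((monic_X_pow _).pow b), hm.natDegree_pow, hd,
    (monic_X_pow (q+1)).natDegree_pow, natDegree_X_pow]
  ring

lemma big_ne_zero (I : Finset (Σ _ : ℕ, ℕ)) (c : (Σ _ : ℕ, ℕ) → F) (q : ℕ) (hq : 2 ≤ q)
    (h1 : ∀ x ∈ I, x.2 ≤ x.1) (h2 : ∀ x ∈ I, x.2 < q) (hc : ∃ x ∈ I, c x ≠ 0) :
    ev17 I c (X ^ q + X : F[X]) (X ^ (q + 1)) ≠ 0 := by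
  classical
  obtain ⟨y, hy, hcy⟩ := hc
  obtain ⟨x0, hx0, hmax⟩ := Finset.exists_max_image (I.filter fun x => c x ≠ 0)
    (fun x => q * x.1 + x.2) ⟨y, by simp [hy, hcy]⟩
  rw [Finset.mem_filter] at hx0
  intro h0
  have := congrArg (fun f => coeff f (q * x0.1 + x0.2)) h0
  simp only [ev17, finsetSum_coeff, coeff_zero] at this
  rw [Finset.sum_eq_single x0] at this
  · have ht := term_natDegree (F := F) q (x0.1 - x0.2) x0.2 hq
    rw [Nat.sub_add_cancel (h1 _ hx0.1)] at ht
    rw [algebraMap_eq, coeff_C_mul, ← ht.1, ht.2.coeff_natDegree] at this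
    simp [hx0.2] at this
  · intro x hx hne
    by_cases hcx : c x = 0
    · simp [hcx]
    have hle := hmax x (by simp [hx, hcx])
    have ht := term_natDegree (F := F) q (x.1 - x.2) x.2 hq
    rw [Nat.sub_add_cancel (h1 _ hx)] at ht
    rw [algebraMap_eq, coeff_C_mul, coeff_eq_zero_of_natDegree_lt, mul_zero]
    rw [ht.1]
    refine lt_of_le_of_ne hle fun he => hne ?_
    have e2 : x.2 = x0.2 := by
      have := congrArg (· % q) he
      simpa [Nat.mul_add_mod, Nat.mod_eq_of_lt (h2 _ hx), Nat.mod_eq_of_lt (h2 _ hx0.1)] using this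
    have e1 : x.1 = x0.1 := by
      have : q * x.1 = q * x0.1 := by omega
      exact Nat.eq_of_mul_eq_mul_left (by omega) this
    cases x; cases x0; simp_all
  · intro h; exact absurd hx0.1 h

lemma big_natDegree (I : Finset (Σ _ : ℕ, ℕ)) (c : (Σ _ : ℕ, ℕ) → F) (q N : ℕ) (hq : 2 ≤ q)
    (h1 : ∀ x ∈ I, x.2 ≤ x.1) (hN : ∀ x ∈ I, q * x.1 + x.2 ≤ N) :
    (ev17 I c (X ^ q + X : F[X]) (X ^ (q + 1))).natDegree ≤ N := by
  apply natDegree_sum_le_of_forall_le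
  intro x hx
  have ht := term_natDegree (F := F) q (x.1 - x.2) x.2 hq
  rw [Nat.sub_add_cancel (h1 _ hx)] at ht
  exact (natDegree_C_mul_le _ _).trans (ht.1.le.trans (hN x hx))

set_option linter.unusedSectionVars false

variable [Fintype F]

lemma prodX (F : Type*) [Field F] [Fintype F] :
    ∏ a : F, (X - C a) = (X ^ Fintype.card F - X : F[X]) := by
  have hm : (X ^ Fintype.card F - X : F[X]).Monic := monic_X_pow_sub (by
    rw [degree_X]; exact_mod_cast Fintype.one_lt_card)
  have := prod_multiset_X_sub_C_of_monic_of_roots_card_eq hm (by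
    rw [FiniteField.roots_X_pow_card_sub_X,
      FiniteField.X_pow_card_sub_X_natDegree_eq F Fintype.one_lt_card]; rfl)
  rw [FiniteField.roots_X_pow_card_sub_X] at this
  exact this

lemma quad_dvd (I : Finset (Σ _ : ℕ, ℕ)) (c : (Σ _ : ℕ, ℕ) → F) {s p : F}
    (h : ∀ x : F, x ^ 2 - s * x + p ≠ 0) (h0 : ev17 I c s p = 0) :
    (X ^ 2 - C s * X + C p : F[X]) ∣
      ev17 I c (X ^ Fintype.card F + X : F[X]) (X ^ (Fintype.card F + 1)) := by
  set f : F[X] := X ^ 2 - C s * X + C p with hf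
  have : Fact (Irreducible f) := ⟨quad_irred h⟩
  set x : AdjoinRoot f := AdjoinRoot.root f with hx
  have hxf : aeval x f = 0 := by rw [AdjoinRoot.aeval_eq, AdjoinRoot.mk_self]
  have e1 : x ^ 2 - algebraMap F _ s * x + algebraMap F _ p = 0 := by
    simpa [hf] using hxf
  have hq0 : Fintype.card F ≠ 0 := Fintype.card_ne_zero
  have e2 : aeval (x ^ Fintype.card F) f = 0 := by
    rw [← expand_aeval, FiniteField.expand_card, map_pow, hxf, zero_pow hq0]
  set y := x ^ Fintype.card F with hy
  have e2' : y ^ 2 - algebraMap F _ s * y + algebraMap F _ p = 0 := by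
    simpa [hf] using e2
  have hne : y - x ≠ 0 := by
    intro hyx
    have := congrArg (aeval x) (prodX F)
    rw [map_prod] at this
    simp only [map_sub, aeval_X, aeval_C, map_pow] at this
    rw [← hy, hyx, Finset.prod_eq_zero_iff] at this
    obtain ⟨a, -, ha⟩ := this
    rw [sub_eq_zero] at ha
    rw [ha] at e1
    apply h a
    apply (algebraMap F (AdjoinRoot f)).injective
    simpa using e1
  have e3 : y = algebraMap F _ s - x := by
    have : (y - x) * (y - (algebraMap F _ s - x)) = 0 := by linear_combination e2' - e1
    rcases mul_eq_zero.1 this with h | h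
    · exact absurd h hne
    · exact sub_eq_zero.1 h
  rw [← AdjoinRoot.mk_eq_zero, ← AdjoinRoot.aeval_eq, ev17_map]
  simp only [map_add, map_pow, aeval_X]
  rw [pow_succ, ← hx, ← hy]
  have a1 : y + x = algebraMap F _ s := by rw [e3]; ring
  have a2 : y * x = algebraMap F _ p := by rw [e3]; linear_combination -e1
  rw [a1, a2]
  have := ev17_map I c (Algebra.ofId F (AdjoinRoot f)) s p
  rw [h0, map_zero] at this
  exact this.symm

lemma count_zeros [DecidableEq F] (G : F[X]) (hG : G ≠ 0) (Z : Finset (F × F))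
    (hZ : ∀ z ∈ Z, (∀ x : F, x ^ 2 - z.1 * x + z.2 ≠ 0) ∧ (X ^ 2 - C z.1 * X + C z.2 : F[X]) ∣ G)
    (S : Finset F) (k : ℕ) (hS : (∏ a ∈ S, (X - C a)) ^ k ∣ G) :
    2 * Z.card + k * S.card ≤ G.natDegree := by
  have d1 : (∏ z ∈ Z, (X ^ 2 - C z.1 * X + C z.2 : F[X])) ∣ G := by
    apply Finset.prod_dvd_of_coprime _ fun z hz => (hZ z hz).2
    intro z hz w hw hzw
    have iz := quad_irred (hZ z hz).1
    have iw := quad_irred (hZ w hw).1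
    refine iz.coprime_iff_not_dvd.2 fun hd => hzw ?_
    have := eq_of_monic_of_associated (quad_monic _ _) (quad_monic _ _) (iz.associated_of_dvd iw hd)
    have c0 := congrArg (fun f => coeff f 0) this
    have c1 := congrArg (fun f => coeff f 1) this
    simp [coeff_X_pow, coeff_C] at c0 c1
    exact Prod.ext c1 c0
  have cop : IsCoprime (∏ z ∈ Z, (X ^ 2 - C z.1 * X + C z.2 : F[X])) ((∏ a ∈ S, (X - C a)) ^ k) := by
    apply IsCoprime.pow_right
    apply IsCoprime.prod_left
    intro z hz
    apply IsCoprime.prod_right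
    intro a _
    apply IsCoprime.symm
    refine (irreducible_X_sub_C a).coprime_iff_not_dvd.2 fun hd => (hZ z hz).1 a ?_
    rw [dvd_iff_isRoot] at hd
    simpa [IsRoot] using hd
  have := natDegree_le_of_dvd (cop.mul_dvd d1 hS) hG
  rw [Monic.natDegree_mul (monic_prod_of_monic _ _ fun z _ => quad_monic _ _)
    ((monic_prod_of_monic _ _ fun a _ => monic_X_sub_C a).pow k),
    natDegree_prod_of_monic _ _ fun z _ => quad_monic _ _,
    (monic_prod_of_monic _ _ fun a _ => monic_X_sub_C a).natDegree_pow,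
    natDegree_prod_of_monic _ _ fun a _ => monic_X_sub_C a] at this
  simp only [quad_natDegree, natDegree_X_sub_C, Finset.sum_const, smul_eq_mul] at this
  linarith

lemma lin_dvd [DecidableEq F] (I : Finset (Σ _ : ℕ, ℕ)) (c : (Σ _ : ℕ, ℕ) → F) (S : Finset F)
    (hS : ∀ a ∈ S, ev17 I c (2 * a) (a ^ 2) = 0) :
    (∏ a ∈ S, (X - C a)) ^ 1 ∣
      ev17 I c (X ^ Fintype.card F + X : F[X]) (X ^ (Fintype.card F + 1)) := by
  rw [pow_one]
  apply Finset.prod_dvd_of_coprime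
  · intro a _ b _ hab
    exact isCoprime_X_sub_C_of_isUnit_sub (sub_ne_zero.2 hab).isUnit
  · intro a ha
    rw [dvd_iff_isRoot, IsRoot, ← coe_aeval_eq_eval]
    change (aeval a) _ = 0
    rw [ev17_map]
    simp only [map_add, map_pow, aeval_X]
    rw [pow_succ, FiniteField.pow_card, ← two_mul, ← pow_two]
    exact hS a ha

lemma root_dvd_odd (I : Finset (Σ _ : ℕ, ℕ)) (c : (Σ _ : ℕ, ℕ) → F) (u : F)
    (h0 : ev17 I c (X : F[X]) (C u * X ^ 2) = 0) {A : Type*} [CommRing A] [Algebra F A] (s p : A) :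
    (p - algebraMap F A u * s ^ 2) ∣ ev17 I c s p := by
  have h : (X - C (C u * X ^ 2) : F[X][X]) ∣ ev17 I c (C X : F[X][X]) X := by
    rw [dvd_iff_isRoot, IsRoot, ← coe_aeval_eq_eval]
    change ((aeval (C u * X ^ 2 : F[X]) : F[X][X] →ₐ[F[X]] F[X]).restrictScalars F) _ = 0
    rw [ev17_map]
    simpa using h0
  obtain ⟨g, hg⟩ := h
  have := congrArg (aevalAeval (R := F) s p) hg
  rw [ev17_map, map_mul] at this
  rw [show aevalAeval s p (C X : F[X][X]) = s by simp, show aevalAeval s p (X : F[X][X]) = p by simp] at this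
  rw [this]
  refine dvd_mul_of_dvd_left (dvd_of_eq ?_) _
  simp

lemma root_dvd_even (I : Finset (Σ _ : ℕ, ℕ)) (c : (Σ _ : ℕ, ℕ) → F)
    (h0 : ev17 I c (0 : F[X]) X = 0) {A : Type*} [CommRing A] [Algebra F A] (s p : A) :
    s ∣ ev17 I c s p := by
  have h : (X - C 0 : F[X][X]) ∣ ev17 I c (X : F[X][X]) (C X) := by
    rw [dvd_iff_isRoot, IsRoot, ← coe_aeval_eq_eval]
    change ((aeval (0 : F[X]) : F[X][X] →ₐ[F[X]] F[X]).restrictScalars F) _ = 0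
    rw [ev17_map]
    simpa using h0
  obtain ⟨g, hg⟩ := h
  have := congrArg (aevalAeval (R := F) p s) hg
  rw [ev17_map, map_mul] at this
  rw [show aevalAeval p s (C X : F[X][X]) = p by simp, show aevalAeval p s (X : F[X][X]) = s by simp] at this
  rw [this]
  refine dvd_mul_of_dvd_left (dvd_of_eq ?_) _
  simp

lemma roots_count [DecidableEq F] (R : F[X]) (hR : R ≠ 0) (S : Finset F) (φ : F → F)
    (hφ : Function.Injective φ) (h : ∀ a ∈ S, R.eval (φ a) = 0) : S.card ≤ R.natDegree := by
  rw [← Finset.card_image_of_injective S hφ]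
  apply card_le_degree_of_subset_roots
  intro x hx
  rw [Finset.mem_val, Finset.mem_image] at hx
  obtain ⟨a, ha, rfl⟩ := hx
  rw [mem_roots hR]
  exact h a ha

/-- the index set -/
def I17 (m ℓ : ℕ) : Finset (Σ _ : ℕ, ℕ) :=
  (Finset.range m).sigma (fun k => Finset.range (if k = m - 1 then ℓ + 1 else k + 1))

lemma mem_I17 {m ℓ : ℕ} (hm : 5 ≤ m) (hℓ : ℓ ≤ m - 1) (x : Σ _ : ℕ, ℕ) :
    x ∈ I17 m ℓ ↔ x.2 ≤ x.1 ∧ (x.1 ≤ m - 2 ∨ (x.1 = m - 1 ∧ x.2 ≤ ℓ)) := by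
  simp only [I17, Finset.mem_sigma, Finset.mem_range]
  split_ifs <;> omega

lemma card_I17 {m ℓ : ℕ} (hm : 5 ≤ m) : (I17 m ℓ).card = m * (m - 1) / 2 + ℓ + 1 := by
  obtain ⟨k, rfl⟩ : ∃ k, m = k + 1 := ⟨m - 1, by omega⟩
  rw [I17, Finset.card_sigma, Finset.sum_range_succ]
  simp only [Finset.card_range, Nat.add_sub_cancel, if_true]
  rw [Finset.sum_congr rfl (g := fun i => i + 1) (fun i hi => by
    rw [Finset.mem_range] at hi; rw [if_neg (by omega)])]
  have := Finset.sum_range_succ' (fun i => i) k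
  have h2 := Finset.sum_range_id (k + 1)
  simp only [Nat.add_sub_cancel] at h2
  omega

/-- Main count. -/
lemma main_count_s17 [DecidableEq F] {t m ℓ q : ℕ} (hq : Fintype.card F = q) (ht : t ≤ q) (hm5 : 5 ≤ m)
    (hmq : m ≤ q - 1) (hℓ : ℓ ≤ m - 1) (T : Finset F) (hT : T.card = t) (g : ℤ)
    (hg : g = if Odd q then min (max (2 * ((m : ℤ) - 2)) ((m : ℤ) + ℓ - 1)) (t : ℤ)
      else if ℓ ≤ m - 2 then max (min ((m : ℤ) - 2) (t : ℤ)) (2 * (t : ℤ) - q)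
      else max (min ((m : ℤ) - 1) (t : ℤ)) (2 * (t : ℤ) - q))
    (c : (Σ _ : ℕ, ℕ) → F) (hc : ∃ x ∈ I17 m ℓ, c x ≠ 0) (Z : Finset (F × F))
    (hZ : ∀ z ∈ Z, (∀ x : F, x ^ 2 - z.1 * x + z.2 ≠ 0) ∧ ev17 (I17 m ℓ) c z.1 z.2 = 0)
    (S : Finset F) (hST : S ⊆ T) (hS : ∀ a ∈ S, ev17 (I17 m ℓ) c (2 * a) (a ^ 2) = 0) :
    2 * Z.card ≤ q * (m - 1) + ℓ ∧
    2 * ((Z.card : ℤ) + S.card) ≤ (q : ℤ) * (m - 1) + ℓ + g := by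
  have hI := mem_I17 hm5 hℓ
  have hI1 : ∀ x ∈ I17 m ℓ, x.2 ≤ x.1 := fun x hx => ((hI x).1 hx).1
  have hI2 : ∀ x ∈ I17 m ℓ, x.2 < q := fun x hx => by have := (hI x).1 hx; omega
  have hI3 : ∀ x ∈ I17 m ℓ, q * x.1 + x.2 ≤ q * (m - 1) + ℓ := fun x hx => by
    obtain ⟨h1, h2 | h2⟩ := (hI x).1 hx
    · have : q * (x.1 + 1) ≤ q * (m - 1) := Nat.mul_le_mul_left _ (by omega)
      rw [mul_add] at this; omega
    · rw [h2.1]; omega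
  set G := ev17 (I17 m ℓ) c (X ^ q + X : F[X]) (X ^ (q + 1)) with hGdef
  have hG0 : G ≠ 0 := big_ne_zero _ c q (by omega) hI1 hI2 hc
  have hGd : G.natDegree ≤ q * (m - 1) + ℓ := big_natDegree _ c q _ (by omega) hI1 hI3
  have hZ' : ∀ z ∈ Z, (∀ x : F, x ^ 2 - z.1 * x + z.2 ≠ 0) ∧
      (X ^ 2 - C z.1 * X + C z.2 : F[X]) ∣ G := fun z hz => ⟨(hZ z hz).1, by
    have := quad_dvd _ c (hZ z hz).1 (hZ z hz).2
    rwa [hq] at this⟩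
  have hr := count_zeros G hG0 Z hZ' S 1 (by
    have := lin_dvd _ c S hS
    rwa [hq] at this)
  have hSt : S.card ≤ t := hT ▸ Finset.card_le_card hST
  have hcast : ((q * (m - 1) + ℓ : ℕ) : ℤ) = (q : ℤ) * (m - 1) + ℓ := by
    push_cast [Nat.cast_sub (show 1 ≤ m by omega)]; ring
  refine ⟨by omega, ?_⟩
  rw [← hcast]
  have huniv : (Finset.univ : Finset F).card = q := by rw [Finset.card_univ, hq]
  have hpX := prodX F
  rw [hq] at hpX
  by_cases hodd : Odd q
  · rw [if_pos hodd] at hg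
    have h2 : (2 : F) ≠ 0 := by
      apply Ring.two_ne_zero
      rw [Ne, FiniteField.even_card_iff_char_two, hq]
      rw [Nat.odd_iff] at hodd; omega
    have h4 : (4 : F) ≠ 0 := by
      rw [show (4 : F) = 2 * 2 by norm_num]; exact mul_ne_zero h2 h2
    set R := ev17 (I17 m ℓ) c (X : F[X]) (C (4⁻¹) * X ^ 2) with hR
    by_cases hR0 : R = 0
    · have hd := root_dvd_odd _ c _ hR0 (X ^ q + X : F[X]) (X ^ (q + 1))
      have := count_zeros G hG0 Z hZ' Finset.univ 2 (by
        rw [hpX]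
        refine dvd_trans ⟨C (-4⁻¹), ?_⟩ hd
        have h44 : (C (4⁻¹ : F)) * 4 = (1 : F[X]) := by
          rw [show (4 : F[X]) = C 4 from (map_ofNat C 4).symm, ← C_mul, inv_mul_cancel₀ h4, C_1]
        rw [algebraMap_eq, C_neg]
        linear_combination (-X ^ (q + 1)) * h44)
      rw [huniv] at this
      omega
    · have h3 := roots_count R hR0 S (fun a => 2 * a) (mul_right_injective₀ h2) (by
        intro a ha
        rw [← coe_aeval_eq_eval]
        change (aeval (2 * a)) _ = 0
        rw [hR, ev17_map]
        have : (4⁻¹ : F) * (2 * a) ^ 2 = a ^ 2 := by field_simp; ring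
        simp only [map_mul, map_pow, aeval_X, aeval_C, Algebra.algebraMap_self, RingHom.id_apply]
        rw [this]
        exact hS a ha)
      have h4 : R.natDegree ≤ max (2 * (m - 2)) (m + ℓ - 1) := by
        apply natDegree_sum_le_of_forall_le
        intro x hx
        refine (natDegree_C_mul_le _ _).trans ?_
        rw [mul_pow, ← C_pow, mul_left_comm]
        refine (natDegree_C_mul_le _ _).trans ?_
        rw [← pow_mul, ← pow_add, natDegree_X_pow]
        have := (hI x).1 hx
        omega
      omega
  · rw [if_neg hodd] at hg
    have hch : CharP F 2 := by
      rw [← (FiniteField.even_card_iff_char_two (F := F)).2 (by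
        rw [hq]; rw [Nat.odd_iff] at hodd; omega)]
      exact ringChar.charP F
    have h2 : (2 : F) = 0 := CharTwo.two_eq_zero
    set R := ev17 (I17 m ℓ) c (0 : F[X]) X with hR
    by_cases hR0 : R = 0
    · have hd := root_dvd_even _ c hR0 (X ^ q + X : F[X]) (X ^ (q + 1))
      have := count_zeros G hG0 Z hZ' Finset.univ 1 (by
        rw [hpX, pow_one, CharTwo.sub_eq_add]
        exact hd)
      rw [huniv] at this
      split_ifs at hg <;> omega
    · have h3 := roots_count R hR0 S (fun a => a ^ 2) (fun a b hab => CharTwo.sq_injective hab) (by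
        intro a ha
        rw [← coe_aeval_eq_eval]
        change (aeval (a ^ 2)) _ = 0
        rw [hR, ev17_map]
        have := hS a ha
        rw [h2, zero_mul] at this
        simpa using this)
      have h4 : R.natDegree ≤ max (m - 2) ℓ := by
        apply natDegree_sum_le_of_forall_le
        intro x hx
        refine (natDegree_C_mul_le _ _).trans ?_
        have hdeg : ((0 : F[X]) ^ (x.1 - x.2) * X ^ x.2).natDegree ≤ x.2 := by
          refine natDegree_mul_le.trans ?_
          rw [natDegree_X_pow]
          have : ((0 : F[X]) ^ (x.1 - x.2)).natDegree = 0 := by simp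
          omega
        have := (hI x).1 hx
        omega
      split_ifs at hg <;> omega

/-- The number of irreducible monic quadratics. -/
lemma card_irr [DecidableEq F] (A : Finset (F × F))
    (hA : ∀ z, z ∈ A ↔ ∀ x : F, x ^ 2 - z.1 * x + z.2 ≠ 0) :
    2 * A.card = Fintype.card F ^ 2 - Fintype.card F := by
  let φ : Sym2 F → F × F := Sym2.lift ⟨fun a b => (a + b, a * b), fun a b => by
    simp [add_comm, mul_comm]⟩
  have hφ : Function.Injective φ := by
    intro u v
    induction u using Sym2.ind with | _ a b
    induction v using Sym2.ind with | _ a' b'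
    intro h
    simp only [φ, Sym2.lift_mk, Prod.mk.injEq] at h
    obtain ⟨h1, h2⟩ := h
    rw [Sym2.eq_iff]
    have : (a - a') * (a - b') = 0 := by linear_combination a * h1 - h2
    rcases mul_eq_zero.1 this with h | h
    · left
      have ha := sub_eq_zero.1 h
      exact ⟨ha, by linear_combination h1 - ha⟩
    · right
      have ha := sub_eq_zero.1 h
      exact ⟨ha, by linear_combination h1 - ha⟩
  have hc : Aᶜ = Finset.univ.image φ := by
    ext ⟨s, p⟩
    simp only [Finset.mem_compl, hA, Finset.mem_image, Finset.mem_univ, true_and]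
    push Not
    constructor
    · rintro ⟨x, hx⟩
      refine ⟨s(x, s - x), ?_⟩
      simp only [φ, Sym2.lift_mk, Prod.mk.injEq]
      exact ⟨by ring, by linear_combination -hx⟩
    · rintro ⟨u, hu⟩
      induction u using Sym2.ind with | _ a b
      simp only [φ, Sym2.lift_mk, Prod.mk.injEq] at hu
      refine ⟨a, ?_⟩
      rw [← hu.1, ← hu.2]; ring
  have h1 := Finset.card_add_card_compl A
  rw [hc, Finset.card_image_of_injective _ hφ, Finset.card_univ, Sym2.card, Fintype.card_prod,
    Nat.choose_two_right, Nat.add_sub_cancel] at h1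
  have h2 : 2 ∣ (Fintype.card F + 1) * Fintype.card F := by
    rw [mul_comm]; exact (Nat.even_mul_succ_self _).two_dvd
  obtain ⟨w, hw⟩ := h2
  rw [hw, Nat.mul_div_cancel_left _ (by norm_num)] at h1
  rw [pow_two]
  have : (Fintype.card F + 1) * Fintype.card F = Fintype.card F * Fintype.card F + Fintype.card F := by ring
  omega


/-- Four distinct points are separated by `1, s, p, s², sp, p², s³, p³`. -/
lemma sep17 {F : Type*} [Field F] (P Q1 Q2 Q3 : F × F) (h1 : Q1 ≠ P) (h2 : Q2 ≠ P) (h3 : Q3 ≠ P) :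
    ∃ (f : F × F → F) (c0 c1 c2 c3 c4 c5 c6 c7 : F),
      (∀ z, f z = c0 + c1 * z.1 + c2 * z.2 + c3 * z.1 ^ 2 + c4 * (z.1 * z.2) + c5 * z.2 ^ 2
        + c6 * z.1 ^ 3 + c7 * z.2 ^ 3) ∧ f P ≠ 0 ∧ f Q1 = 0 ∧ f Q2 = 0 ∧ f Q3 = 0 := by
  -- the case of a horizontal and a vertical neighbour
  have key : ∀ A B D : F × F, A.1 = P.1 → A ≠ P → B.2 = P.2 → B ≠ P → D ≠ P →
      ∃ (f : F × F → F) (c0 c1 c2 c3 c4 c5 c6 c7 : F),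
      (∀ z, f z = c0 + c1 * z.1 + c2 * z.2 + c3 * z.1 ^ 2 + c4 * (z.1 * z.2) + c5 * z.2 ^ 2
        + c6 * z.1 ^ 3 + c7 * z.2 ^ 3) ∧ f P ≠ 0 ∧ f A = 0 ∧ f B = 0 ∧ f D = 0 := by
    rintro A B D hA hA' hB hB' hD
    have ha : A.2 - P.2 ≠ 0 := fun h => hA' (Prod.ext hA (sub_eq_zero.1 h))
    have hb : B.1 - P.1 ≠ 0 := fun h => hB' (Prod.ext (sub_eq_zero.1 h) hB)
    set a := A.2 - P.2 with haa
    set b := B.1 - P.1 with hbb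
    by_cases hd : D.1 = P.1
    · have hd' : P.2 - D.2 ≠ 0 := fun h => hD (Prod.ext hd (sub_eq_zero.1 h).symm)
      refine ⟨fun z => ((z.1 - P.1) * a + (z.2 - P.2) * b - a * b) * (z.2 - D.2),
        D.2 * (P.1 * a + P.2 * b + a * b), -a * D.2, -(P.1 * a + P.2 * b + a * b) - b * D.2,
        0, a, b, 0, 0, fun z => by ring, ?_, ?_, ?_, ?_⟩
      · have : ((P.1 - P.1) * a + (P.2 - P.2) * b - a * b) * (P.2 - D.2)
          = -(a * b * (P.2 - D.2)) := by ring
        dsimp only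
        rw [this]
        exact neg_ne_zero.2 (mul_ne_zero (mul_ne_zero ha hb) hd')
      · dsimp only; rw [hA, ← haa]; ring
      · dsimp only; rw [hB, ← hbb]; ring
      · dsimp only; ring
    · have hd' : P.1 - D.1 ≠ 0 := fun h => hd (sub_eq_zero.1 h).symm
      refine ⟨fun z => ((z.1 - P.1) * a + (z.2 - P.2) * b - a * b) * (z.1 - D.1),
        D.1 * (P.1 * a + P.2 * b + a * b), -(P.1 * a + P.2 * b + a * b) - a * D.1, -b * D.1,
        a, b, 0, 0, 0, fun z => by ring, ?_, ?_, ?_, ?_⟩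
      · have : ((P.1 - P.1) * a + (P.2 - P.2) * b - a * b) * (P.1 - D.1)
          = -(a * b * (P.1 - D.1)) := by ring
        dsimp only
        rw [this]
        exact neg_ne_zero.2 (mul_ne_zero (mul_ne_zero ha hb) hd')
      · dsimp only; rw [hA, ← haa]; ring
      · dsimp only; rw [hB, ← hbb]; ring
      · dsimp only; ring
  have nn : ∀ Q : F × F, Q ≠ P → Q.1 = P.1 → Q.2 = P.2 → False := fun Q h a b => h (Prod.ext a b)
  by_cases hs : Q1.1 ≠ P.1 ∧ Q2.1 ≠ P.1 ∧ Q3.1 ≠ P.1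
  · refine ⟨fun z => (z.1 - Q1.1) * (z.1 - Q2.1) * (z.1 - Q3.1), -(Q1.1 * Q2.1 * Q3.1),
      Q1.1 * Q2.1 + Q1.1 * Q3.1 + Q2.1 * Q3.1, 0, -(Q1.1 + Q2.1 + Q3.1), 0, 0, 1, 0,
      fun z => by ring, ?_, by simp, by simp, by simp⟩
    exact mul_ne_zero (mul_ne_zero (sub_ne_zero.2 hs.1.symm) (sub_ne_zero.2 hs.2.1.symm))
      (sub_ne_zero.2 hs.2.2.symm)
  by_cases hp : Q1.2 ≠ P.2 ∧ Q2.2 ≠ P.2 ∧ Q3.2 ≠ P.2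
  · refine ⟨fun z => (z.2 - Q1.2) * (z.2 - Q2.2) * (z.2 - Q3.2), -(Q1.2 * Q2.2 * Q3.2),
      0, Q1.2 * Q2.2 + Q1.2 * Q3.2 + Q2.2 * Q3.2, 0, 0, -(Q1.2 + Q2.2 + Q3.2), 0, 1,
      fun z => by ring, ?_, by simp, by simp, by simp⟩
    exact mul_ne_zero (mul_ne_zero (sub_ne_zero.2 hp.1.symm) (sub_ne_zero.2 hp.2.1.symm))
      (sub_ne_zero.2 hp.2.2.symm)
  have hs' : Q1.1 = P.1 ∨ Q2.1 = P.1 ∨ Q3.1 = P.1 := by tauto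
  have hp' : Q1.2 = P.2 ∨ Q2.2 = P.2 ∨ Q3.2 = P.2 := by tauto
  rcases hs' with a | a | a <;> rcases hp' with b | b | b
  · exact (nn _ h1 a b).elim
  · obtain ⟨f, c0, c1, c2, c3, c4, c5, c6, c7, h, e0, e1, e2, e3⟩ := key _ _ _ a h1 b h2 h3
    exact ⟨f, c0, c1, c2, c3, c4, c5, c6, c7, h, e0, e1, e2, e3⟩
  · obtain ⟨f, c0, c1, c2, c3, c4, c5, c6, c7, h, e0, e1, e2, e3⟩ := key _ _ _ a h1 b h3 h2
    exact ⟨f, c0, c1, c2, c3, c4, c5, c6, c7, h, e0, e1, e3, e2⟩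
  · obtain ⟨f, c0, c1, c2, c3, c4, c5, c6, c7, h, e0, e1, e2, e3⟩ := key _ _ _ a h2 b h1 h3
    exact ⟨f, c0, c1, c2, c3, c4, c5, c6, c7, h, e0, e2, e1, e3⟩
  · exact (nn _ h2 a b).elim
  · obtain ⟨f, c0, c1, c2, c3, c4, c5, c6, c7, h, e0, e1, e2, e3⟩ := key _ _ _ a h2 b h3 h1
    exact ⟨f, c0, c1, c2, c3, c4, c5, c6, c7, h, e0, e3, e1, e2⟩
  · obtain ⟨f, c0, c1, c2, c3, c4, c5, c6, c7, h, e0, e1, e2, e3⟩ := key _ _ _ a h3 b h1 h2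
    exact ⟨f, c0, c1, c2, c3, c4, c5, c6, c7, h, e0, e2, e3, e1⟩
  · obtain ⟨f, c0, c1, c2, c3, c4, c5, c6, c7, h, e0, e1, e2, e3⟩ := key _ _ _ a h3 b h2 h1
    exact ⟨f, c0, c1, c2, c3, c4, c5, c6, c7, h, e0, e3, e2, e1⟩
  · exact (nn _ h3 a b).elim

/-- The monomial codeword `s^{k-b} p^b`. -/
def mon17 {F : Type*} [Field F] {n : ℕ} (P : Fin n → F × F) (x : Σ _ : ℕ, ℕ) : Fin n → F :=
  fun i => (P i).1 ^ (x.1 - x.2) * (P i).2 ^ x.2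

/-- Index set of the small code. -/
def J17 : Finset (Σ _ : ℕ, ℕ) :=
  {⟨0, 0⟩, ⟨1, 0⟩, ⟨1, 1⟩, ⟨2, 0⟩, ⟨2, 1⟩, ⟨2, 2⟩, ⟨3, 0⟩, ⟨3, 3⟩}

lemma dual17 {F : Type*} [Field F] [DecidableEq F] {n : ℕ} (hn : 9 ≤ n)
    (P : Fin n → F × F) (hP : Function.Injective P) :
    5 ≤ minDist (dualCode (Submodule.span F (mon17 P '' (J17 : Set (Σ _ : ℕ, ℕ))))) := by
  set D := Submodule.span F (mon17 P '' (J17 : Set (Σ _ : ℕ, ℕ))) with hD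
  have hmon : ∀ u ∈ dualCode D, ∀ x ∈ J17, ∑ i, u i * mon17 P x i = 0 := fun u hu x hx =>
    hu _ (Submodule.subset_span ⟨x, hx, rfl⟩)
  unfold minDist
  apply le_csInf
  · -- nonempty
    let L : (Fin n → F) →ₗ[F] (J17 → F) :=
      { toFun := fun u x => ∑ i, u i * mon17 P x i
        map_add' := by intro a b; ext x; simp [add_mul, Finset.sum_add_distrib]
        map_smul' := by intro a b; ext x; simp [mul_assoc, Finset.mul_sum] }
    have hk : LinearMap.ker L ≠ ⊥ := by
      apply LinearMap.ker_ne_bot_of_finrank_lt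
      rw [Module.finrank_pi, Module.finrank_pi, Fintype.card_fin, Fintype.card_coe]
      exact lt_of_lt_of_le (by decide) hn
    obtain ⟨u, hu, hu0⟩ := (Submodule.ne_bot_iff _).1 hk
    refine ⟨_, u, ?_, hu0, rfl⟩
    intro v hv
    rw [LinearMap.mem_ker] at hu
    induction hv using Submodule.span_induction with
    | mem w hw =>
      obtain ⟨x, hx, rfl⟩ := hw
      exact congrFun hu ⟨x, hx⟩
    | zero => simp
    | add a b _ _ ha hb => simp [mul_add, Finset.sum_add_distrib, ha, hb]
    | smul a b _ hb =>
      simp only [Pi.smul_apply, smul_eq_mul, mul_left_comm _ a]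
      rw [← Finset.mul_sum, hb, mul_zero]
  · rintro w ⟨u, hu, hu0, rfl⟩
    by_contra hlt
    push Not at hlt
    obtain ⟨i0, hi0⟩ := Function.ne_iff.1 hu0
    obtain ⟨S, hS, hS4⟩ := Finset.exists_superset_card_eq (n := 4)
      (s := Finset.univ.filter fun i => u i ≠ 0) (by
        have : (Finset.univ.filter fun i => u i ≠ 0).card = hammingNorm u := rfl
        omega) (by rw [Fintype.card_fin]; omega)
    have hiS : i0 ∈ S := hS (by simpa using hi0)
    have hc3 : (S.erase i0).card = 3 := by rw [Finset.card_erase_of_mem hiS, hS4]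
    obtain ⟨x, y, z, -, -, -, hxyz⟩ := Finset.card_eq_three.1 hc3
    have hne : ∀ j ∈ S.erase i0, P j ≠ P i0 := fun j hj h => Finset.ne_of_mem_erase hj (hP h)
    obtain ⟨f, c0, c1, c2, c3, c4, c5, c6, c7, hf, f0, f1, f2, f3⟩ :=
      sep17 (P i0) (P x) (P y) (P z) (hne x (by simp [hxyz])) (hne y (by simp [hxyz]))
        (hne z (by simp [hxyz]))
    have hsum1 : ∑ i, u i * f (P i) = u i0 * f (P i0) := by
      apply Finset.sum_eq_single i0 _ (by simp)
      intro j _ hj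
      by_cases hjS : j ∈ S
      · have : j ∈ S.erase i0 := Finset.mem_erase.2 ⟨hj, hjS⟩
        rw [hxyz] at this
        simp only [Finset.mem_insert, Finset.mem_singleton] at this
        rcases this with rfl | rfl | rfl <;> simp [f1, f2, f3]
      · have : u j = 0 := by
          by_contra h
          exact hjS (hS (by simpa using h))
        simp [this]
    have m0 := hmon u hu ⟨0, 0⟩ (by decide)
    have m1 := hmon u hu ⟨1, 0⟩ (by decide)
    have m2 := hmon u hu ⟨1, 1⟩ (by decide)
    have m3 := hmon u hu ⟨2, 0⟩ (by decide)
    have m4 := hmon u hu ⟨2, 1⟩ (by decide)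
    have m5 := hmon u hu ⟨2, 2⟩ (by decide)
    have m6 := hmon u hu ⟨3, 0⟩ (by decide)
    have m7 := hmon u hu ⟨3, 3⟩ (by decide)
    have hsum2 : ∑ i, u i * f (P i) = c0 * ∑ i, u i * mon17 P ⟨0, 0⟩ i
        + c1 * ∑ i, u i * mon17 P ⟨1, 0⟩ i + c2 * ∑ i, u i * mon17 P ⟨1, 1⟩ i
        + c3 * ∑ i, u i * mon17 P ⟨2, 0⟩ i + c4 * ∑ i, u i * mon17 P ⟨2, 1⟩ i
        + c5 * ∑ i, u i * mon17 P ⟨2, 2⟩ i + c6 * ∑ i, u i * mon17 P ⟨3, 0⟩ i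
        + c7 * ∑ i, u i * mon17 P ⟨3, 3⟩ i := by
      simp only [Finset.mul_sum, ← Finset.sum_add_distrib]
      refine Finset.sum_congr rfl fun i _ => ?_
      rw [hf]
      simp only [mon17]
      ring
    rw [m0, m1, m2, m3, m4, m5, m6, m7, hsum1] at hsum2
    simp only [mul_zero, add_zero] at hsum2
    exact (mul_ne_zero hi0 f0) hsum2

end Helpers

theorem statement17 {q t m ℓ : ℕ}
    (hq : ∃ p e : ℕ, p.Prime ∧ 0 < e ∧ q = p ^ e) (hq5 : 5 ≤ q)
    (ht : t ≤ q) (hm5 : 5 ≤ m) (hmq : m ≤ q - 1) (hℓ : ℓ ≤ m - 1)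
    (F : Type*) [Field F] [Fintype F] [DecidableEq F] (hF : Fintype.card F = q)
    (n : ℕ) (hn : n = t + (q ^ 2 - q) / 2)
    (g : ℤ)
    (hg : g = if Odd q then min (max (2 * ((m : ℤ) - 2)) ((m : ℤ) + ℓ - 1)) (t : ℤ)
      else if ℓ ≤ m - 2 then max (min ((m : ℤ) - 2) (t : ℤ)) (2 * (t : ℤ) - q)
      else max (min ((m : ℤ) - 1) (t : ℤ)) (2 * (t : ℤ) - q))
    (δ : ℚ)
    (hδ : δ = (n : ℚ) - ((q : ℚ) * ((m : ℚ) - 1) + (ℓ : ℚ) + (g : ℚ)) / 2) :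
    ∃ D C : Submodule F (Fin n → F), D ≤ C ∧
      Module.finrank F C = Module.finrank F D + (m * (m - 1) / 2 + ℓ - 7) ∧
      5 ≤ minDist (dualCode D) ∧
      ∀ v ∈ C, v ≠ 0 → δ ≤ (hammingNorm v : ℚ) := by
  classical
  obtain ⟨T, -, hT⟩ := Finset.exists_subset_card_eq (s := (Finset.univ : Finset F)) (n := t)
    (by rw [Finset.card_univ, hF]; exact ht)
  obtain ⟨A, hA⟩ : ∃ A : Finset (F × F), ∀ z, z ∈ A ↔ ∀ x : F, x ^ 2 - z.1 * x + z.2 ≠ 0 :=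
    ⟨Finset.univ.filter fun z => ∀ x : F, x ^ 2 - z.1 * x + z.2 ≠ 0, by simp⟩
  have hAc := card_irr A hA
  rw [hF] at hAc
  let τ : F → F × F := fun a => (2 * a, a ^ 2)
  have hτ : Function.Injective τ := by
    intro a b hab
    simp only [τ, Prod.mk.injEq] at hab
    have : (a - b) ^ 2 = 0 := by linear_combination a * hab.1 - hab.2
    exact sub_eq_zero.1 (pow_eq_zero_iff (by norm_num) |>.1 this)
  have hdis : Disjoint A (T.image τ) := by
    rw [Finset.disjoint_left]
    intro z hz hz'
    obtain ⟨a, -, rfl⟩ := Finset.mem_image.1 hz'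
    exact (hA _).1 hz a (by simp only [τ]; ring)
  have hW : (A ∪ T.image τ).card = n := by
    rw [Finset.card_union_of_disjoint hdis, Finset.card_image_of_injective _ hτ, hT]
    omega
  let e := (Finset.equivFinOfCardEq hW).symm
  let P : Fin n → F × F := fun i => (e i : F × F)
  have hP : Function.Injective P := fun i j h => e.injective (Subtype.ext h)
  have hPs : ∀ z ∈ A ∪ T.image τ, ∃ i, P i = z := fun z hz =>
    ⟨e.symm ⟨z, hz⟩, by simp [P]⟩
  have hPm : ∀ i, P i ∈ A ∪ T.image τ := fun i => (e i).2
  have hqq : q * (m - 1) + ℓ < q ^ 2 - q := by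
    have : q ^ 2 - q = q * (q - 1) := by rw [pow_two, Nat.mul_sub, mul_one]
    rw [this]
    have h1 : q * (m - 1) + q ≤ q * (q - 1) := by
      rw [← Nat.mul_succ]; exact Nat.mul_le_mul_left _ (by omega)
    omega
  have hn9 : 9 ≤ n := by
    have : 5 * 4 ≤ q * (m - 1) := Nat.mul_le_mul hq5 (by omega)
    omega
  set I := I17 m ℓ with hI
  have hcomb : ∀ c : (Σ _ : ℕ, ℕ) → F, ∀ i,
      (∑ x ∈ I, c x • mon17 P x) i = ev17 I c (P i).1 (P i).2 := by
    intro c i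
    simp [ev17, mon17, Finset.sum_apply]
  have hmain := fun c hc Z hZ S hST hS =>
    main_count_s17 hF ht hm5 hmq hℓ T hT g hg c hc Z hZ S hST hS
  have hind : LinearIndepOn F (mon17 P) (I : Set (Σ _ : ℕ, ℕ)) := by
    rw [linearIndepOn_finset_iff]
    intro c hc0
    by_contra hcon
    push Not at hcon
    have := (hmain c hcon A (fun z hz => ⟨(hA z).1 hz, by
      obtain ⟨i, rfl⟩ := hPs z (Finset.mem_union_left _ hz)
      rw [← hcomb, hc0]; rfl⟩) ∅ (by simp) (by simp)).1
    omega
  have hJI : (J17 : Set (Σ _ : ℕ, ℕ)) ⊆ I := by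
    intro x hx
    rw [Finset.mem_coe] at hx ⊢
    rw [hI, mem_I17 hm5 hℓ]
    simp only [J17, Finset.mem_insert, Finset.mem_singleton] at hx
    rcases hx with rfl | rfl | rfl | rfl | rfl | rfl | rfl | rfl <;> simp <;> omega
  have hrank : ∀ K : Finset (Σ _ : ℕ, ℕ), (K : Set (Σ _ : ℕ, ℕ)) ⊆ I →
      Module.finrank F (Submodule.span F (mon17 P '' (K : Set (Σ _ : ℕ, ℕ)))) = K.card := by
    intro K hK
    have h := hind.mono hK
    rw [Set.image_eq_range]
    have := finrank_span_eq_card (R := F) (b := fun x : (K : Set (Σ _ : ℕ, ℕ)) => mon17 P x) h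
    rw [this]
    simp
  refine ⟨Submodule.span F (mon17 P '' (J17 : Set (Σ _ : ℕ, ℕ))),
    Submodule.span F (mon17 P '' (I : Set (Σ _ : ℕ, ℕ))),
    Submodule.span_mono (Set.image_mono hJI), ?_, dual17 hn9 P hP, ?_⟩
  · rw [hrank I subset_rfl, hrank J17 hJI, hI, card_I17 hm5, show J17.card = 8 by decide]
    have : 5 * 4 ≤ m * (m - 1) := Nat.mul_le_mul hm5 (by omega)
    omega
  · intro v hv hv0
    rw [Submodule.mem_span_image_finset_iff_exists_fun'] at hv
    obtain ⟨c, rfl⟩ := hv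
    have hc : ∃ x ∈ I, c x ≠ 0 := by
      by_contra hcon
      push Not at hcon
      exact hv0 (Finset.sum_eq_zero fun x hx => by rw [hcon x hx, zero_smul])
    set v := ∑ x ∈ I, c x • mon17 P x with hv
    set Z := A.filter fun z => ev17 I c z.1 z.2 = 0 with hZ
    set S := T.filter fun a => ev17 I c (2 * a) (a ^ 2) = 0 with hS
    have h2 := (hmain c hc Z (fun z hz => by
      rw [hZ, Finset.mem_filter] at hz
      exact ⟨(hA z).1 hz.1, hz.2⟩) S (Finset.filter_subset _ _) (fun a ha => by
      rw [hS, Finset.mem_filter] at ha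
      exact ha.2)).2
    have hzero : (Finset.univ.filter fun i => v i = 0).card ≤ Z.card + S.card := by
      rw [← Finset.card_image_of_injective _ hP, ← Finset.card_image_of_injective S hτ]
      refine (Finset.card_le_card ?_).trans (Finset.card_union_le _ _)
      intro z hz
      obtain ⟨i, hi, rfl⟩ := Finset.mem_image.1 hz
      have hi0 : v i = 0 := (Finset.mem_filter.1 hi).2
      rw [hv, hcomb] at hi0
      rcases Finset.mem_union.1 (hPm i) with h | h
      · exact Finset.mem_union_left _ (Finset.mem_filter.2 ⟨h, hi0⟩)
      · obtain ⟨a, ha, hai⟩ := Finset.mem_image.1 h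
        rw [← hai] at hi0 ⊢
        exact Finset.mem_union_right _
          (Finset.mem_image_of_mem _ (Finset.mem_filter.2 ⟨ha, hi0⟩))
    have htot : (Finset.univ.filter fun i => v i = 0).card + hammingNorm v = n := by
      have := Finset.card_filter_add_card_filter_not (s := (Finset.univ : Finset (Fin n)))
        (fun i => v i = 0)
      rw [Finset.card_univ, Fintype.card_fin] at this
      exact this
    have h3 : 2 * (n : ℤ) ≤ 2 * (hammingNorm v : ℤ) + ((q : ℤ) * (m - 1) + ℓ + g) := by
      omega
    have h4 : 2 * (n : ℚ) ≤ 2 * (hammingNorm v : ℚ) + ((q : ℚ) * (m - 1) + ℓ + g) := by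
      exact_mod_cast h3
    rw [hδ]
    linarith
end
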